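/- arXiv:1211.7195 — 3 statements merged into one kernel-verified Lean document; each statement's English description precedes it below -/
import Mathlib

section
/- Let R > 0 and let u₀ ∈ 𝓗² satisfy Θ_R u₀ = u₀ and ‖u₁(0)‖² + ‖u₂(0)‖² = 1; let u be the solution of the nonlinear Landau–Zener system with datum u₀ and v its gauge transform. Let Ωⱼ = lim_{s→+∞} ‖uⱼ(s)‖² and Aⱼ = lim_{s→−∞} ‖uⱼ(s)‖² (j = 1,2; these limits exist), and set m₊ = (δ/2)(f₁(Ω₁,Ω₂) − f₂(Ω₁,Ω₂)) and m₋ = (δ/2)(f₁(A₁,A₂) − f₂(A₁,A₂)). Then there exist ν = (ν₁,ν₂) ∈ 𝓗² with ‖ν₁‖² = Ω₁ and ‖ν₂‖² = Ω₂, μ = (μ₁,μ₂) ∈ 𝓗² with ‖μ₁‖² = A₁ and ‖μ₂‖² = A₂, a number s₀ ≥ 1 and a constant C > 0 (depending only on R and the fixed data θ, δ, f₁, f₂, G) such that for all s ≥ s₀: ‖v₁(s) − e^{iφ(s+m₊,GG*)}ν₁‖ ≤ C/s and ‖v₂(s) − e^{−iφ(s+m₊,G*G)}ν₂‖ ≤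 C/s, and for all s ≤ −s₀: ‖v₁(s) − e^{iφ(s+m₋,GG*)}μ₁‖ ≤ C/|s| and ‖v₂(s) − e^{−iφ(s+m₋,G*G)}μ₂‖ ≤ C/|s|. -/
open ContinuousLinearMap Complex Filter Topology
open scoped InnerProductSpace

noncomputable section

variable {H : Type*} [NormedAddCommGroup H] [InnerProductSpace ℂ H] [CompleteSpace H]

/-- Functional calculus `χ(A)` of a selfadjoint operator `A` for a complex-valued
function `χ : ℝ → ℂ` (defined via the real continuous functional calculus applied to
the real and imaginary parts of `χ`). -/
def fc (χ : ℝ → ℂ) (A : H →L[ℂ] H) : H →L[ℂ] H :=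
  cfc (fun x : ℝ => (χ x).re) A + Complex.I • cfc (fun x : ℝ => (χ x).im) A

/-- The commutation assumption: for every continuous `χ : ℝ → ℂ`,
`χ(GG*)G = Gχ(G*G)` and `χ(G*G)G* = G*χ(GG*)`. -/
def CommHyp (G : H →L[ℂ] H) : Prop :=
  ∀ χ : ℝ → ℂ, Continuous χ →
    (fc χ (G * ContinuousLinearMap.adjoint G)) ∘L G
        = G ∘L (fc χ (ContinuousLinearMap.adjoint G * G)) ∧
    (fc χ (ContinuousLinearMap.adjoint G * G)) ∘L ContinuousLinearMap.adjoint G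
        = ContinuousLinearMap.adjoint G ∘L (fc χ (G * ContinuousLinearMap.adjoint G))

/-- The equivalence between `𝓗²` (with its Hilbert space structure) and `𝓗 × 𝓗`. -/
def eqv : WithLp 2 (H × H) ≃L[ℂ] H × H := WithLp.prodContinuousLinearEquiv 2 ℂ H H

/-- The operator `V(s)(w₁,w₂) = (s·w₁ + Gw₂, G*w₁ − s·w₂)` on `𝓗²`. -/
def Vop (G : H →L[ℂ] H) (s : ℝ) : WithLp 2 (H × H) →L[ℂ] WithLp 2 (H × H) :=
  (eqv (H := H)).symm.toContinuousLinearMap ∘L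
    ((((s : ℂ) • ContinuousLinearMap.fst ℂ H H + G ∘L ContinuousLinearMap.snd ℂ H H)).prod
      ((ContinuousLinearMap.adjoint G) ∘L ContinuousLinearMap.fst ℂ H H
        - (s : ℂ) • ContinuousLinearMap.snd ℂ H H)) ∘L
    (eqv (H := H)).toContinuousLinearMap

/-- `F₁(u) = f₁(‖u₁‖², ‖u₂‖²)`. -/
def F1 (f₁ : ℝ × ℝ → ℝ) (u : WithLp 2 (H × H)) : ℝ := f₁ (‖u.fst‖ ^ 2, ‖u.snd‖ ^ 2)

/-- `F₂(u) = f₂(‖u₁‖², ‖u₂‖²)`. -/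
def F2 (f₂ : ℝ × ℝ → ℝ) (u : WithLp 2 (H × H)) : ℝ := f₂ (‖u.fst‖ ^ 2, ‖u.snd‖ ^ 2)

/-- The nonlinear term `F(u)u = (F₁(u)u₁, F₂(u)u₂)`. -/
def nlt (f₁ f₂ : ℝ × ℝ → ℝ) (u : WithLp 2 (H × H)) : WithLp 2 (H × H) :=
  (WithLp.equiv 2 (H × H)).symm ((F1 f₁ u) • u.fst, (F2 f₂ u) • u.snd)

/-- `u` is a (global, `C¹`) solution of `−i u′(s) = V(s)u(s) + δ F(u(s))u(s)`:
equivalently, `u′(s) = i (V(s)u(s) + δ F(u(s))u(s))` for all `s`. -/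
def IsLZSol (G : H →L[ℂ] H) (δ : ℝ) (f₁ f₂ : ℝ × ℝ → ℝ) (u : ℝ → WithLp 2 (H × H)) : Prop :=
  ∀ s : ℝ, HasDerivAt u (Complex.I • (Vop G s (u s) + δ • nlt f₁ f₂ (u s))) s

/-- `f ∈ C²(ℝ²;ℝ)` with bounded second derivative. -/
def C2Bdd (f : ℝ × ℝ → ℝ) : Prop :=
  ContDiff ℝ 2 f ∧ ∃ C : ℝ, ∀ p : ℝ × ℝ, ‖iteratedFDeriv ℝ 2 f p‖ ≤ C

/-- `θ ∈ C_c^∞(ℝ;ℝ)`, `0 ≤ θ ≤ 1`, `θ = 1` on `(−1/2,1/2)` and `θ = 0` outside `[−1,1]`. -/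
def IsCutoff (θ : ℝ → ℝ) : Prop :=
  ContDiff ℝ (⊤ : ℕ∞) θ ∧ HasCompactSupport θ ∧ (∀ x, 0 ≤ θ x ∧ θ x ≤ 1) ∧
    (∀ x, |x| < 1/2 → θ x = 1) ∧ (∀ x, 1 < |x| → θ x = 0)

/-- The cutoff operator `Θ_R = diag(θ(GG*/R²), θ(G*G/R²))`. -/
def Theta (G : H →L[ℂ] H) (θ : ℝ → ℝ) (R : ℝ) :
    WithLp 2 (H × H) →L[ℂ] WithLp 2 (H × H) :=
  (eqv (H := H)).symm.toContinuousLinearMap ∘L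
    ((cfc (fun x : ℝ => θ (x / R ^ 2)) (G * ContinuousLinearMap.adjoint G)).prodMap
      (cfc (fun x : ℝ => θ (x / R ^ 2)) (ContinuousLinearMap.adjoint G * G))) ∘L
    (eqv (H := H)).toContinuousLinearMap

/-- The phase `φ(s,λ) = s²/2 + (λ/2)·log|s|`. -/
def phase (s lam : ℝ) : ℝ := s ^ 2 / 2 + lam / 2 * Real.log |s|

/-- The unitary operator `e^{iφ(s,GG*)}` on `𝓗`. -/
def ePhaseP (G : H →L[ℂ] H) (s : ℝ) : H →L[ℂ] H :=
  fc (fun lam => Complex.exp (Complex.I * (phase s lam))) (G * ContinuousLinearMap.adjoint G)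

/-- The unitary operator `e^{−iφ(s,G*G)}` on `𝓗`. -/
def ePhaseM (G : H →L[ℂ] H) (s : ℝ) : H →L[ℂ] H :=
  fc (fun lam => Complex.exp (-(Complex.I * (phase s lam))))
    (ContinuousLinearMap.adjoint G * G)

/-- The model asymptotic first component `e^{iδF₁(ω)s + iϕ}·e^{iφ(s,GG*)}ω₁`. -/
def asym1 (G : H →L[ℂ] H) (δ : ℝ) (f₁ : ℝ × ℝ → ℝ) (ω : WithLp 2 (H × H)) (ϕ : ℝ)
    (s : ℝ) : H :=
  Complex.exp (Complex.I * (δ * F1 f₁ ω * s + ϕ)) • (ePhaseP G s ω.fst)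

/-- The model asymptotic second component `e^{iδF₂(ω)s − iϕ}·e^{−iφ(s,G*G)}ω₂`. -/
def asym2 (G : H →L[ℂ] H) (δ : ℝ) (f₂ : ℝ × ℝ → ℝ) (ω : WithLp 2 (H × H)) (ϕ : ℝ)
    (s : ℝ) : H :=
  Complex.exp (Complex.I * (δ * F2 f₂ ω * s - ϕ)) • (ePhaseM G s ω.snd)

/-- `α` is the incoming scattering state (at `s → −∞`) of `u`, with phase shift `ϕ`. -/
def Incoming (G : H →L[ℂ] H) (δ : ℝ) (f₁ f₂ : ℝ × ℝ → ℝ) (α : WithLp 2 (H × H)) (ϕ : ℝ)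
    (u : ℝ → WithLp 2 (H × H)) : Prop :=
  Tendsto (fun s => ‖(u s).fst - asym1 G δ f₁ α ϕ s‖ + ‖(u s).snd - asym2 G δ f₂ α ϕ s‖)
    atBot (𝓝 0)

/-- `ω` is the outgoing scattering state (at `s → +∞`) of `u`, with phase shift `ϕ`. -/
def Outgoing (G : H →L[ℂ] H) (δ : ℝ) (f₁ f₂ : ℝ × ℝ → ℝ) (ω : WithLp 2 (H × H)) (ϕ : ℝ)
    (u : ℝ → WithLp 2 (H × H)) : Prop :=
  Tendsto (fun s => ‖(u s).fst - asym1 G δ f₁ ω ϕ s‖ + ‖(u s).snd - asym2 G δ f₂ ω ϕ s‖)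
    atTop (𝓝 0)

/-- `M(u) = (δ/2)(F₁(u) + F₂(u))`. -/
def Mscal (δ : ℝ) (f₁ f₂ : ℝ × ℝ → ℝ) (u : WithLp 2 (H × H)) : ℝ :=
  δ / 2 * (F1 f₁ u + F2 f₂ u)

/-- `m(u) = (δ/2)(F₁(u) − F₂(u))`. -/
def mscal (δ : ℝ) (f₁ f₂ : ℝ × ℝ → ℝ) (u : WithLp 2 (H × H)) : ℝ :=
  δ / 2 * (F1 f₁ u - F2 f₂ u)

/-- The gauge transform `v(s) = e^{−i∫₀ˢ M(u(τ))dτ}·u(s)`. -/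
def gaugeT (δ : ℝ) (f₁ f₂ : ℝ × ℝ → ℝ) (u : ℝ → WithLp 2 (H × H)) :
    ℝ → WithLp 2 (H × H) :=
  fun s => Complex.exp (-(Complex.I * (∫ τ in (0:ℝ)..s, Mscal δ f₁ f₂ (u τ)))) • u s

/-- `σ(s) = s + m(u(s))`. -/
def sigma (δ : ℝ) (f₁ f₂ : ℝ × ℝ → ℝ) (u : ℝ → WithLp 2 (H × H)) (s : ℝ) : ℝ :=
  s + mscal δ f₁ f₂ (u s)

/-- The operator `Λ_t = diag((t² + GG*)^{1/2}, (t² + G*G)^{1/2})` on `𝓗²`. -/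
def LamOp (G : H →L[ℂ] H) (t : ℝ) : WithLp 2 (H × H) →L[ℂ] WithLp 2 (H × H) :=
  (eqv (H := H)).symm.toContinuousLinearMap ∘L
    ((cfc (fun x : ℝ => Real.sqrt (t ^ 2 + x)) (G * ContinuousLinearMap.adjoint G)).prodMap
      (cfc (fun x : ℝ => Real.sqrt (t ^ 2 + x)) (ContinuousLinearMap.adjoint G * G))) ∘L
    (eqv (H := H)).toContinuousLinearMap

/-- The operator `Λ_t⁻¹ = diag((t² + GG*)^{-1/2}, (t² + G*G)^{-1/2})` on `𝓗²`. -/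
def LamInv (G : H →L[ℂ] H) (t : ℝ) : WithLp 2 (H × H) →L[ℂ] WithLp 2 (H × H) :=
  (eqv (H := H)).symm.toContinuousLinearMap ∘L
    ((cfc (fun x : ℝ => (Real.sqrt (t ^ 2 + x))⁻¹)
        (G * ContinuousLinearMap.adjoint G)).prodMap
      (cfc (fun x : ℝ => (Real.sqrt (t ^ 2 + x))⁻¹)
        (ContinuousLinearMap.adjoint G * G))) ∘L
    (eqv (H := H)).toContinuousLinearMap

/-- The projection `Π_t^+ = (1/2)(Id + Λ_t⁻¹V(t))`. -/
def PiP (G : H →L[ℂ] H) (t : ℝ) : WithLp 2 (H × H) →L[ℂ] WithLp 2 (H × H) :=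
  (2 : ℂ)⁻¹ • (1 + LamInv G t ∘L Vop G t)

/-- The projection `Π_t^- = (1/2)(Id − Λ_t⁻¹V(t))`. -/
def PiM (G : H →L[ℂ] H) (t : ℝ) : WithLp 2 (H × H) →L[ℂ] WithLp 2 (H × H) :=
  (2 : ℂ)⁻¹ • (1 - LamInv G t ∘L Vop G t)

/-- `m̃(x,y) = (δ/2)(f₁(x,y) − f₂(x,y))`. -/
def mtilde (δ : ℝ) (f₁ f₂ : ℝ × ℝ → ℝ) : ℝ × ℝ → ℝ := fun p => δ / 2 * (f₁ p - f₂ p)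

/-- `m̲(s) = (∂₁m̃ − ∂₂m̃)(‖v₁(s)‖², ‖v₂(s)‖²)`. -/
def mbar (δ : ℝ) (f₁ f₂ : ℝ × ℝ → ℝ) (v : ℝ → WithLp 2 (H × H)) (s : ℝ) : ℝ :=
  fderiv ℝ (mtilde δ f₁ f₂) (‖(v s).fst‖ ^ 2, ‖(v s).snd‖ ^ 2) (1, 0) -
    fderiv ℝ (mtilde δ f₁ f₂) (‖(v s).fst‖ ^ 2, ‖(v s).snd‖ ^ 2) (0, 1)


/-- The operator `A(a,b,c,d)(w₁,w₂) = (a(GG*)w₁ + b(GG*)Gw₂, c(G*G)G*w₁ + d(G*G)w₂)`. -/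
def Aop (G : H →L[ℂ] H) (a b c d : ℝ → ℂ) :
    WithLp 2 (H × H) →L[ℂ] WithLp 2 (H × H) :=
  (eqv (H := H)).symm.toContinuousLinearMap ∘L
    (((fc a (G * ContinuousLinearMap.adjoint G)) ∘L ContinuousLinearMap.fst ℂ H H
        + (fc b (G * ContinuousLinearMap.adjoint G)) ∘L G ∘L ContinuousLinearMap.snd ℂ H H).prod
      ((fc c (ContinuousLinearMap.adjoint G * G)) ∘L (ContinuousLinearMap.adjoint G)
          ∘L ContinuousLinearMap.fst ℂ H H
        + (fc d (ContinuousLinearMap.adjoint G * G)) ∘L ContinuousLinearMap.snd ℂ H H)) ∘L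
    (eqv (H := H)).toContinuousLinearMap

/-- The operator `𝒦(w₁,w₂) = (−Gw₂, G*w₁)` on `𝓗²`. -/
def Kcal (G : H →L[ℂ] H) : WithLp 2 (H × H) →L[ℂ] WithLp 2 (H × H) :=
  (eqv (H := H)).symm.toContinuousLinearMap ∘L
    ((-(G ∘L ContinuousLinearMap.snd ℂ H H)).prod
      ((ContinuousLinearMap.adjoint G) ∘L ContinuousLinearMap.fst ℂ H H)) ∘L
    (eqv (H := H)).toContinuousLinearMap

theorem fc_eq_cfc_complex (χ : ℝ → ℂ) (hχ : Continuous χ) {A : H →L[ℂ] H}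
    (hA : IsSelfAdjoint A) : fc χ A = cfc (fun z : ℂ => χ z.re) A := by
  have hA' : IsStarNormal A := hA.isStarNormal
  rw [fc, cfc_real_eq_complex _ hA, cfc_real_eq_complex _ hA, ← cfc_smul _ _ A,
    ← cfc_add A _ _]
  refine cfc_congr fun z _ => ?_
  simp only [smul_eq_mul, mul_comm Complex.I, Complex.re_add_im]

/-- The operator `e^{c φ(s, A)}`, unitary for `c = ± i` and `A` selfadjoint. -/
def phaseExp (c : ℂ) (A : H →L[ℂ] H) (s : ℝ) : H →L[ℂ] H :=
  Complex.exp (c * (s ^ 2 / 2)) • NormedSpace.exp ((c * (Real.log s / 2 : ℝ)) • A)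

theorem fc_exp_phase (c : ℂ) {A : H →L[ℂ] H} (hA : IsSelfAdjoint A) (s : ℝ) :
    fc (fun lam => Complex.exp (c * (phase s lam))) A = phaseExp c A s := by
  have hA' : IsStarNormal A := hA.isStarNormal
  rw [fc_eq_cfc_complex _ (by unfold phase; fun_prop) hA, phaseExp,
    ← CFC.complex_exp_eq_normedSpace_exp, ← cfc_comp_smul _ _ A, ← cfc_smul _ _ A]
  refine cfc_congr fun z hz => ?_
  have hz' : ((z.re : ℝ) : ℂ) = z := (hA.mem_spectrum_eq_re hz).symm
  simp only [phase, smul_eq_mul, Real.log_abs]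
  rw [← Complex.exp_add]
  congr 1
  push_cast
  rw [hz']
  ring

theorem hasDerivAt_phaseExp (c : ℂ) (A : H →L[ℂ] H) {s : ℝ} (hs : 0 < s) :
    HasDerivAt (phaseExp c A) ((c * s) • phaseExp c A s + (c * (2 * s)⁻¹) • (phaseExp c A s * A)) s := by
  have h1 : HasDerivAt (fun s : ℝ => Complex.exp (c * ((s:ℂ) ^ 2 / 2)))
      (Complex.exp (c * ((s:ℂ) ^ 2 / 2)) * (c * s)) s := by
    have h : HasDerivAt (fun z : ℂ => Complex.exp (c * (z ^ 2 / 2)))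
      (Complex.exp (c * ((s:ℂ) ^ 2 / 2)) * (c * s)) (s : ℂ) := by
      have := (((hasDerivAt_pow 2 (s:ℂ)).div_const 2).const_mul c).cexp
      refine this.congr_deriv ?_
      push_cast; ring
    exact h.comp_ofReal
  have h2 : HasDerivAt (fun s : ℝ => NormedSpace.exp ((c * (Real.log s / 2 : ℝ)) • A))
      ((c * (2 * s)⁻¹) • (NormedSpace.exp ((c * (Real.log s / 2 : ℝ)) • A) * A)) s := by
    have hl : HasDerivAt (fun s : ℝ => c * ((Real.log s / 2 : ℝ) : ℂ)) (c * (2 * s)⁻¹) s := by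
      have := (((Real.hasDerivAt_log hs.ne').div_const 2).ofReal_comp).const_mul c
      refine this.congr_deriv ?_
      push_cast
      rw [mul_inv]; ring
    exact (hasDerivAt_exp_smul_const A (c * (Real.log s / 2 : ℝ))).scomp s hl
  have := h1.smul h2
  refine this.congr_deriv ?_
  simp only [phaseExp, smul_mul_assoc, smul_smul]
  rw [add_comm]
  congr 2 <;> ring

theorem phaseExp_mul_phaseExp_neg (c : ℂ) (A : H →L[ℂ] H) (s : ℝ) :
    phaseExp c A s * phaseExp (-c) A s = 1 := by
  let _ : NormedAlgebra ℚ (H →L[ℂ] H) := NormedAlgebra.restrictScalars ℚ ℂ _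
  unfold phaseExp
  have hc : Commute ((c * (Real.log s / 2 : ℝ)) • A) ((-c * (Real.log s / 2 : ℝ)) • A) :=
    ((Commute.refl A).smul_left _).smul_right _
  rw [smul_mul_smul_comm, ← NormedSpace.exp_add_of_commute hc, ← Complex.exp_add, ← add_smul]
  simp

theorem norm_phaseExp_apply {c : ℂ} (hc : star c = -c) {A : H →L[ℂ] H} (hA : IsSelfAdjoint A)
    (s : ℝ) (x : H) : ‖phaseExp c A s x‖ = ‖x‖ := by
  let _ : NormedAlgebra ℚ (H →L[ℂ] H) := NormedAlgebra.restrictScalars ℚ ℂ _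
  have h1 : NormedSpace.exp ((c * (Real.log s / 2 : ℝ)) • A) ∈ unitary (H →L[ℂ] H) := by
    apply NormedSpace.exp_mem_unitary_of_mem_skewAdjoint
    rw [skewAdjoint.mem_iff, star_smul, hA.star_eq, star_mul', hc]
    simp
  have h2 : ‖Complex.exp (c * ((s : ℂ) ^ 2 / 2))‖ = 1 := by
    have hre : c.re = 0 := by
      have := congrArg Complex.re hc
      simp at this; linarith
    rw [Complex.norm_exp]
    have : (c * ((s : ℂ) ^ 2 / 2)) = c * ((s ^ 2 / 2 : ℝ) : ℂ) := by push_cast; rfl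
    rw [this, Complex.re_mul_ofReal, hre]; simp
  rw [phaseExp, _root_.smul_apply, norm_smul, h2, one_mul]
  exact ContinuousLinearMap.norm_map_of_mem_unitary h1 x

section Decay

variable {ι E F : Type*} [NormedAddCommGroup E] [NormedAddCommGroup F]

theorem eventually_top_prod_atTop {P : ι × ℝ → Prop} :
    (∀ᶠ x in (⊤ : Filter ι) ×ˢ (atTop : Filter ℝ), P x) ↔ ∃ s₀, ∀ i, ∀ s ≥ s₀, P (i, s) := by
  rw [eventually_prod_iff]
  constructor
  · rintro ⟨pa, ha, pb, hb, h⟩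
    obtain ⟨s₀, hs₀⟩ := eventually_atTop.1 hb
    exact ⟨s₀, fun i s hs => h (Filter.eventually_top.1 ha i) (hs₀ s hs)⟩
  · rintro ⟨s₀, h⟩
    exact ⟨fun _ => True, by simp, fun s => s₀ ≤ s, eventually_ge_atTop s₀,
      fun _ _ hs => h _ _ hs⟩

/-- `f(i, s) = O(s⁻ᵏ)` as `s → +∞`, uniformly in the parameter `i`. -/
def Decay (k : ℕ) (f : ι × ℝ → E) : Prop :=
  f =O[(⊤ : Filter ι) ×ˢ (atTop : Filter ℝ)] fun x => (x.2)⁻¹ ^ k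

namespace Decay

variable {j k : ℕ} {f g : ι × ℝ → E}

theorem exists_bound (h : Decay k f) :
    ∃ C > 0, ∃ s₀ ≥ 1, ∀ i, ∀ s ≥ s₀, ‖f (i, s)‖ ≤ C * s⁻¹ ^ k := by
  obtain ⟨C, hC, h⟩ := Asymptotics.IsBigO.exists_pos h
  obtain ⟨s₀, hs⟩ := eventually_top_prod_atTop.1 h.bound
  refine ⟨C, hC, max s₀ 1, le_max_right _ _, fun i s h' => ?_⟩
  have h0 : 0 ≤ s := by linarith [le_max_right s₀ 1]
  have := hs i s (le_trans (le_max_left _ _) h')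
  rwa [Real.norm_of_nonneg (by positivity)] at this

theorem of_bound {C s₀ : ℝ} (h : ∀ i, ∀ s ≥ s₀, ‖f (i, s)‖ ≤ C * s⁻¹ ^ k) : Decay k f := by
  refine Asymptotics.IsBigO.of_bound C (eventually_top_prod_atTop.2 ⟨max s₀ 0, fun i s hs => ?_⟩)
  have h0 : 0 ≤ s := (le_max_right _ _).trans hs
  rw [Real.norm_of_nonneg (by positivity)]
  exact h i s ((le_max_left _ _).trans hs)

theorem of_bounded {C : ℝ} (h : ∀ x, ‖f x‖ ≤ C) : Decay 0 f :=
  of_bound (C := C) (s₀ := 0) fun i s _ => by simpa using h (i, s)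

theorem mono (h : Decay k f) (hjk : j ≤ k) : Decay j f := by
  obtain ⟨C, hC, s₀, hs₀, h⟩ := h.exists_bound
  refine of_bound (C := C) (s₀ := s₀) fun i s hs => (h i s hs).trans ?_
  have h1 : 1 ≤ s := hs₀.trans hs
  gcongr C * ?_
  exact pow_le_pow_of_le_one (by positivity) (inv_le_one_of_one_le₀ h1) hjk

theorem add (hf : Decay k f) (hg : Decay k g) : Decay k fun x => f x + g x :=
  Asymptotics.IsBigO.add hf hg

theorem sub (hf : Decay k f) (hg : Decay k g) : Decay k fun x => f x - g x :=
  Asymptotics.IsBigO.sub hf hg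

theorem congr' (hf : Decay k f)
    (h : ∀ᶠ x in (⊤ : Filter ι) ×ˢ (atTop : Filter ℝ), f x = g x) : Decay k g :=
  Asymptotics.IsBigO.congr' hf h (EventuallyEq.refl _ _)

theorem of_norm_le {g : ι × ℝ → F} (hf : Decay k f) (h : ∀ x, ‖g x‖ ≤ ‖f x‖) : Decay k g :=
  (Asymptotics.isBigO_of_le _ h).trans hf

theorem smul {𝕜 : Type*} [NormedField 𝕜] [NormedSpace 𝕜 E] {c : ι × ℝ → 𝕜}
    (hc : Decay j c) (hf : Decay k f) : Decay (j + k) fun x => c x • f x := by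
  unfold Decay
  simp only [pow_add]
  exact Asymptotics.IsBigO.smul hc hf

theorem mul {R : Type*} [NormedField R] {f g : ι × ℝ → R}
    (hf : Decay j f) (hg : Decay k g) : Decay (j + k) fun x => f x * g x :=
  hf.smul hg

theorem pow {R : Type*} [NormedField R] {f : ι × ℝ → R}
    (hf : Decay j f) (n : ℕ) : Decay (j * n) fun x => f x ^ n := by
  unfold Decay
  simp only [pow_mul]
  exact Asymptotics.IsBigO.pow hf n

theorem const (c : E) : Decay 0 fun _ : ι × ℝ => c :=
  of_bounded (C := ‖c‖) fun _ => le_rfl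

theorem ofReal {f : ι × ℝ → ℝ} (hf : Decay k f) : Decay k fun x => (f x : ℂ) :=
  hf.of_norm_le fun x => by simp

theorem snd_add {m : ι × ℝ → ℝ} (hm : Decay 0 m) : Decay 1 fun x => (x.2 + m x)⁻¹ := by
  obtain ⟨C, hC, s₀, hs₀, h⟩ := hm.exists_bound
  refine of_bound (C := 2) (s₀ := max s₀ (2 * C)) fun i s hs => ?_
  have h1 := h i s ((le_max_left _ _).trans hs)
  have h2 := (le_max_right _ _).trans hs
  simp only [pow_zero, mul_one, Real.norm_eq_abs] at h1
  have h3 := (abs_le.1 h1).1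
  have h4 : s / 2 ≤ s + m (i, s) := by linarith
  have h5 : 0 < s / 2 := by linarith
  rw [norm_inv, Real.norm_of_nonneg (h5.le.trans h4)]
  calc (s + m (i, s))⁻¹ ≤ (s / 2)⁻¹ := inv_anti₀ h5 h4
    _ = 2 * s⁻¹ ^ 1 := by rw [inv_div, pow_one]; rfl

theorem eventually_snd_add_pos {m : ι × ℝ → ℝ} (hm : Decay 0 m) :
    ∀ᶠ x in (⊤ : Filter ι) ×ˢ (atTop : Filter ℝ), 0 < x.2 + m x := by
  obtain ⟨C, hC, s₀, hs₀, h⟩ := hm.exists_bound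
  refine eventually_top_prod_atTop.2 ⟨max s₀ (2 * C), fun i s hs => ?_⟩
  have h1 := h i s ((le_max_left _ _).trans hs)
  have h2 := (le_max_right _ _).trans hs
  simp only [pow_zero, mul_one, Real.norm_eq_abs] at h1
  have h3 := (abs_le.1 h1).1
  simp only
  linarith

theorem tendsto (hf : Decay (k + 1) f) (i : ι) :
    Tendsto (fun s => f (i, s)) atTop (𝓝 0) := by
  obtain ⟨C, hC, s₀, hs₀, h⟩ := hf.exists_bound
  refine squeeze_zero_norm' ((eventually_ge_atTop s₀).mono fun s hs => h i s hs) ?_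
  have := ((tendsto_inv_atTop_zero (𝕜 := ℝ)).pow (k + 1)).const_mul C
  simpa using this

/-- A family of functions whose derivatives are `O(s⁻ᵏ⁻¹)`, `k ≥ 1`, converges at rate
`O(s⁻ᵏ)`. -/
theorem exists_limit [NormedSpace ℝ E] [CompleteSpace E] {F F' : ι × ℝ → E} (hk : k ≠ 0)
    (hF : ∀ᶠ x in (⊤ : Filter ι) ×ˢ (atTop : Filter ℝ),
      HasDerivAt (fun s => F (x.1, s)) (F' x) x.2)
    (hF' : Decay (k + 1) F') :
    ∃ L : ι → E, (∀ i, Tendsto (fun s => F (i, s)) atTop (𝓝 (L i))) ∧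
      Decay k fun x => F x - L x.1 := by
  obtain ⟨s₁, h1⟩ := eventually_top_prod_atTop.1 hF
  obtain ⟨C, hC, s₀, hs₀, h⟩ := hF'.exists_bound
  have key : ∀ i, ∀ s ≥ max s₀ s₁, ∀ t ≥ s, ‖F (i, t) - F (i, s)‖ ≤ C * s⁻¹ ^ k := by
    intro i s hs t ht
    have hs0 : 1 ≤ s := hs₀.trans ((le_max_left _ _).trans hs)
    have hd : ∀ x ∈ Set.Icc s t, HasDerivAt (fun s => F (i, s)) (F' (i, x)) x := fun x hx =>
      h1 i x ((le_max_right _ _).trans (hs.trans hx.1))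
    have hB : ∀ x ∈ Set.Icc s t, HasDerivAt (fun x : ℝ => C * (s⁻¹ ^ k - x⁻¹ ^ k))
        (C * (k * x⁻¹ ^ (k + 1))) x := by
      intro x hx
      have hx0 : x ≠ 0 := by linarith [hx.1]
      refine ((((hasDerivAt_inv hx0).pow k).const_sub (s⁻¹ ^ k)).const_mul C).congr_deriv ?_
      obtain ⟨n, rfl⟩ := Nat.exists_eq_succ_of_ne_zero hk
      simp only [Nat.succ_eq_add_one, Nat.add_sub_cancel]
      rw [← inv_pow]
      push_cast
      ring
    have := image_norm_le_of_norm_deriv_right_le_deriv_boundary'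
      (f := fun x => F (i, x) - F (i, s)) (f' := fun x => F' (i, x)) (a := s) (b := t)
      (B := fun x : ℝ => C * (s⁻¹ ^ k - x⁻¹ ^ k)) (B' := fun x => C * (k * x⁻¹ ^ (k + 1)))
      (fun x hx => ((hd x hx).continuousAt.sub continuousAt_const).continuousWithinAt)
      (fun x hx => ((hd x ⟨hx.1, hx.2.le⟩).sub_const _).hasDerivWithinAt)
      (by simp)
      (fun x hx => (hB x hx).continuousAt.continuousWithinAt)
      (fun x hx => (hB x ⟨hx.1, hx.2.le⟩).hasDerivWithinAt)
      (fun x hx => by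
        refine (h i x ((le_max_left _ _).trans (hs.trans hx.1))).trans ?_
        have hx0 : 0 < x := by linarith [hx.1]
        have hk1 : (1 : ℝ) ≤ k := by exact_mod_cast Nat.one_le_iff_ne_zero.2 hk
        gcongr
        exact le_mul_of_one_le_left (by positivity) hk1)
      (Set.right_mem_Icc.2 ht)
    refine this.trans ?_
    have ht0 : 0 < t := by linarith
    gcongr
    have : 0 ≤ t⁻¹ ^ k := by positivity
    linarith
  have hlim : ∀ i, ∃ L, Tendsto (fun s => F (i, s)) atTop (𝓝 L) := by
    intro i
    refine cauchy_map_iff_exists_tendsto.1 ?_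
    refine Metric.cauchy_iff.2 ⟨inferInstance, fun ε hε => ?_⟩
    have ht : Tendsto (fun s : ℝ => C * s⁻¹ ^ k) atTop (𝓝 0) := by
      have := ((tendsto_inv_atTop_zero (𝕜 := ℝ)).pow k).const_mul C
      simpa [hk] using this
    obtain ⟨s, hs1, hs2⟩ := ((ht.eventually_lt_const (half_pos hε)).and
      (eventually_ge_atTop (max s₀ s₁))).exists
    refine ⟨(fun s => F (i, s)) '' Set.Ici s, image_mem_map (Ici_mem_atTop s), ?_⟩
    rintro _ ⟨x, hx, rfl⟩ _ ⟨y, hy, rfl⟩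
    have e1 := key i s hs2 x hx
    have e2 := key i s hs2 y hy
    rw [← dist_eq_norm] at e1 e2
    have := dist_triangle_right (F (i, x)) (F (i, y)) (F (i, s))
    simp only
    linarith
  choose L hL using hlim
  refine ⟨L, hL, of_bound (C := C) (s₀ := max s₀ s₁) fun i s hs => ?_⟩
  have ht : Tendsto (fun t => ‖F (i, t) - F (i, s)‖) atTop (𝓝 ‖L i - F (i, s)‖) :=
    ((hL i).sub_const _).norm
  rw [norm_sub_rev]
  exact le_of_tendsto ht ((eventually_ge_atTop s).mono fun t ht => key i s hs t ht)

end Decay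

end Decay

theorem abs_taylor_two_le {g : ℝ → ℝ} (hg : ContDiff ℝ 2 g) {B : ℝ}
    (hB : ∀ x ∈ Set.Icc (0 : ℝ) 1, |deriv (deriv g) x| ≤ B) {x y : ℝ}
    (hx : x ∈ Set.Icc (0 : ℝ) 1) (hy : y ∈ Set.Icc (0 : ℝ) 1) :
    |g x - g y - deriv g y * (x - y)| ≤ B * |x - y| ^ 2 := by
  have hg1 : ContDiff ℝ 1 (deriv g) := ContDiff.deriv' (n := 1) (by simpa [one_add_one_eq_two] using hg)
  have hd : ∀ z, HasDerivAt g (deriv g z) z := fun z =>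
    (hg.differentiable (by norm_num) z).hasDerivAt
  have hdd : ∀ z, HasDerivAt (deriv g) (deriv (deriv g) z) z := fun z =>
    (hg1.differentiable (by norm_num) z).hasDerivAt
  have h1 : ∀ z ∈ Set.Icc (0 : ℝ) 1, |deriv g z - deriv g y| ≤ B * |z - y| := fun z hz =>
    (convex_Icc (0 : ℝ) 1).norm_image_sub_le_of_norm_hasDerivWithin_le
      (fun w _ => (hdd w).hasDerivWithinAt) hB hy hz
  have hB0 : 0 ≤ B := (abs_nonneg _).trans (hB x hx)
  have hsub : Set.uIcc y x ⊆ Set.Icc 0 1 := Set.uIcc_subset_Icc hy hx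
  have h2 := (convex_uIcc y x).norm_image_sub_le_of_norm_hasDerivWithin_le
    (f := fun z => g z - deriv g y * z) (f' := fun z => deriv g z - deriv g y * 1)
    (C := B * |x - y|)
    (fun w _ => ((hd w).sub ((hasDerivAt_id w).const_mul _)).hasDerivWithinAt)
    (fun w hw => by
      rw [mul_one]
      refine (h1 w (hsub hw)).trans ?_
      gcongr B * ?_
      rcases Set.mem_uIcc.1 hw with h | h
      · rw [abs_of_nonneg (by linarith), abs_of_nonneg (by linarith)]; linarith
      · rw [abs_of_nonpos (by linarith), abs_of_nonpos (by linarith)]; linarith)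
    Set.left_mem_uIcc Set.right_mem_uIcc
  simp only [Real.norm_eq_abs] at h2
  calc _ = |g x - deriv g y * x - (g y - deriv g y * y)| := by ring_nf
    _ ≤ B * |x - y| * |x - y| := h2
    _ = _ := by ring

/-- Asymptotics of the scalar part of the Landau-Zener system: `p` stands for `‖v₁‖²`, `X` and
`Y` for the real and imaginary parts of `⟪v₁, G v₂⟫`. -/
theorem decay_scalar {ι : Type*} {g : ℝ → ℝ} (hg : ContDiff ℝ 2 g)
    {p X Y r : ι → ℝ → ℝ} {Ω : ι → ℝ} {C : ℝ}
    (hp : ∀ i s, HasDerivAt (p i) (-2 * Y i s) s)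
    (hX : ∀ i s, HasDerivAt (X i) (2 * (s + g (p i s)) * Y i s) s)
    (hY : ∀ i s, HasDerivAt (Y i) (-2 * (s + g (p i s)) * X i s + r i s) s)
    (hp01 : ∀ i s, p i s ∈ Set.Icc (0 : ℝ) 1)
    (hXC : ∀ i s, |X i s| ≤ C) (hYC : ∀ i s, |Y i s| ≤ C) (hrC : ∀ i s, |r i s| ≤ C)
    (hΩ : ∀ i, Tendsto (p i) atTop (𝓝 (Ω i))) :
    (∃ B, ∀ i, |g (Ω i)| ≤ B) ∧ (∃ B, ∀ i, |deriv g (Ω i)| ≤ B) ∧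
    Decay 1 (fun x : ι × ℝ => g (p x.1 x.2) - g (Ω x.1)) ∧
    Decay 2 (fun x : ι × ℝ => g (p x.1 x.2) - g (Ω x.1) -
      deriv g (Ω x.1) * (-2 * (x.2 + g (p x.1 x.2)) * X x.1 x.2 + r x.1 x.2) *
        ((x.2 + g (Ω x.1))⁻¹ ^ 2 * 2⁻¹)) := by
  have hg1 : ContDiff ℝ 1 (deriv g) := ContDiff.deriv' (n := 1) (by simpa [one_add_one_eq_two] using hg)
  have hd : ∀ z, HasDerivAt g (deriv g z) z := fun z =>
    (hg.differentiable (by norm_num) z).hasDerivAt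
  have hdd : ∀ z, HasDerivAt (deriv g) (deriv (deriv g) z) z := fun z =>
    (hg1.differentiable (by norm_num) z).hasDerivAt
  obtain ⟨B0, hB0⟩ := isCompact_Icc.exists_bound_of_continuousOn
    (s := Set.Icc (0 : ℝ) 1) hg.continuous.continuousOn
  obtain ⟨B1, hB1⟩ := isCompact_Icc.exists_bound_of_continuousOn
    (s := Set.Icc (0 : ℝ) 1) hg1.continuous.continuousOn
  obtain ⟨B2, hB2⟩ := isCompact_Icc.exists_bound_of_continuousOn
    (s := Set.Icc (0 : ℝ) 1) (hg1.continuous_deriv (by norm_num)).continuousOn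
  have hΩ01 : ∀ i, Ω i ∈ Set.Icc (0 : ℝ) 1 := fun i =>
    isClosed_Icc.mem_of_tendsto (hΩ i) (Eventually.of_forall fun s => hp01 i s)
  have dX : Decay 0 fun x : ι × ℝ => X x.1 x.2 := .of_bounded fun x => hXC x.1 x.2
  have dY : Decay 0 fun x : ι × ℝ => Y x.1 x.2 := .of_bounded fun x => hYC x.1 x.2
  have dr : Decay 0 fun x : ι × ℝ => r x.1 x.2 := .of_bounded fun x => hrC x.1 x.2
  have d0 : Decay 0 fun x : ι × ℝ => g (p x.1 x.2) :=
    .of_bounded fun x => hB0 _ (hp01 x.1 x.2)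
  have d1 : Decay 0 fun x : ι × ℝ => deriv g (p x.1 x.2) :=
    .of_bounded fun x => hB1 _ (hp01 x.1 x.2)
  have d2 : Decay 0 fun x : ι × ℝ => deriv (deriv g) (p x.1 x.2) :=
    .of_bounded fun x => hB2 _ (hp01 x.1 x.2)
  have dΩ : Decay 0 fun x : ι × ℝ => g (Ω x.1) := .of_bounded fun x => hB0 _ (hΩ01 x.1)
  have dκ : Decay 0 fun x : ι × ℝ => deriv g (Ω x.1) := .of_bounded fun x => hB1 _ (hΩ01 x.1)
  have dσ := Decay.snd_add d0
  have dS := Decay.snd_add dΩ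
  have dσ' : Decay 0 fun x : ι × ℝ => 1 + deriv g (p x.1 x.2) * (-2 * Y x.1 x.2) :=
    (Decay.const 1).add (d1.mul ((Decay.const (-2)).mul dY))
  obtain ⟨L, hL, hLd⟩ := Decay.exists_limit (k := 2) (ι := ι) two_ne_zero
    (F := fun x => p x.1 x.2 + X x.1 x.2 * (x.2 + g (p x.1 x.2))⁻¹
      - 2⁻¹ * (Y x.1 x.2 + deriv g (p x.1 x.2) * X x.1 x.2 ^ 2) * (x.2 + g (p x.1 x.2))⁻¹ ^ 3)
    (F' := fun x => 2⁻¹ * (2 * deriv (deriv g) (p x.1 x.2) * Y x.1 x.2 * X x.1 x.2 ^ 2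
          - r x.1 x.2) * (x.2 + g (p x.1 x.2))⁻¹ ^ 3
        + 3 / 2 * (Y x.1 x.2 + deriv g (p x.1 x.2) * X x.1 x.2 ^ 2)
          * (1 + deriv g (p x.1 x.2) * (-2 * Y x.1 x.2)) * (x.2 + g (p x.1 x.2))⁻¹ ^ 4)
    (by
      filter_upwards [Decay.eventually_snd_add_pos d0] with x hx
      have hσ : HasDerivAt (fun s => s + g (p x.1 s))
          (1 + deriv g (p x.1 x.2) * (-2 * Y x.1 x.2)) x.2 :=
        (hasDerivAt_id _).add ((hd _).comp _ (hp x.1 x.2))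
      have hσi := hσ.fun_inv hx.ne'
      have h1 : HasDerivAt (fun s => deriv g (p x.1 s))
          (deriv (deriv g) (p x.1 x.2) * (-2 * Y x.1 x.2)) x.2 := (hdd _).comp _ (hp x.1 x.2)
      refine (((hp x.1 x.2).add ((hX x.1 x.2).mul hσi)).sub
        ((((hY x.1 x.2).add (h1.mul ((hX x.1 x.2).pow 2))).const_mul 2⁻¹).mul
          (hσi.pow 3))).congr_deriv ?_
      have hx' := hx.ne'
      simp only [Pi.pow_apply, Pi.add_apply, Pi.mul_apply, Nat.reduceSub, inv_pow]
      field_simp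
      ring)
    (by
      have e1 := (((Decay.const (2⁻¹ : ℝ)).mul (((((Decay.const (2 : ℝ)).mul d2).mul dY).mul
        (dX.pow 2)).sub dr)).mul (dσ.pow 3))
      have e2 := ((((Decay.const (3 / 2 : ℝ)).mul (dY.add (d1.mul (dX.pow 2)))).mul dσ').mul
        (dσ.pow 4))
      exact e1.add (e2.mono (by norm_num)))
  have dq : Decay 3 fun x : ι × ℝ => 2⁻¹ * (Y x.1 x.2 + deriv g (p x.1 x.2) * X x.1 x.2 ^ 2) *
      (x.2 + g (p x.1 x.2))⁻¹ ^ 3 :=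
    ((Decay.const (2⁻¹ : ℝ)).mul (dY.add (d1.mul (dX.pow 2)))).mul (dσ.pow 3)
  have dXσ : Decay 1 fun x : ι × ℝ => X x.1 x.2 * (x.2 + g (p x.1 x.2))⁻¹ := dX.mul dσ
  have hLΩ : ∀ i, L i = Ω i := by
    intro i
    refine tendsto_nhds_unique (hL i) ?_
    have := ((hΩ i).add (dXσ.tendsto (k := 0) i)).sub (dq.tendsto (k := 2) i)
    simpa using this
  have hpΩ2 : Decay 2 fun x : ι × ℝ => p x.1 x.2 - Ω x.1 +
      X x.1 x.2 * (x.2 + g (p x.1 x.2))⁻¹ := by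
    refine (hLd.add (dq.mono (by norm_num))).congr' (Eventually.of_forall fun x => ?_)
    simp only [hLΩ]
    ring
  have hpΩ : Decay 1 fun x : ι × ℝ => p x.1 x.2 - Ω x.1 := by
    refine ((hpΩ2.mono (by norm_num)).sub dXσ).congr' (Eventually.of_forall fun x => ?_)
    ring
  have hT : Decay 2 fun x : ι × ℝ => g (p x.1 x.2) - g (Ω x.1) -
      deriv g (Ω x.1) * (p x.1 x.2 - Ω x.1) := by
    refine ((Decay.const B2).mul (hpΩ.pow 2)).of_norm_le fun x => ?_
    have := abs_taylor_two_le hg hB2 (hp01 x.1 x.2) (hΩ01 x.1)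
    rw [Real.norm_eq_abs]
    refine this.trans ?_
    rw [Real.norm_eq_abs, abs_mul, abs_pow]
    gcongr
    exact le_abs_self _
  have hgd : Decay 1 (fun x : ι × ℝ => g (p x.1 x.2) - g (Ω x.1)) := by
    refine ((hT.mono (by norm_num)).add (dκ.mul hpΩ)).congr' (Eventually.of_forall fun x => ?_)
    ring
  refine ⟨⟨B0, fun i => hB0 _ (hΩ01 i)⟩, ⟨B1, fun i => hB1 _ (hΩ01 i)⟩, hgd, ?_⟩
  -- the remainder, written with the common denominators `σ` and `S`
  have e1 : Decay 2 fun x : ι × ℝ => deriv g (Ω x.1) * (p x.1 x.2 - Ω x.1 +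
      X x.1 x.2 * (x.2 + g (p x.1 x.2))⁻¹) := dκ.mul hpΩ2
  have e2 : Decay 3 fun x : ι × ℝ => deriv g (Ω x.1) * X x.1 x.2 *
      (g (p x.1 x.2) - g (Ω x.1)) * (x.2 + g (p x.1 x.2))⁻¹ * (x.2 + g (Ω x.1))⁻¹ :=
    (((dκ.mul dX).mul hgd).mul dσ).mul dS
  have e3 : Decay 3 fun x : ι × ℝ => deriv g (Ω x.1) * X x.1 x.2 *
      (g (p x.1 x.2) - g (Ω x.1)) * (x.2 + g (Ω x.1))⁻¹ ^ 2 :=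
    ((dκ.mul dX).mul hgd).mul (dS.pow 2)
  have e4 : Decay 2 fun x : ι × ℝ => deriv g (Ω x.1) * r x.1 x.2 *
      2⁻¹ * (x.2 + g (Ω x.1))⁻¹ ^ 2 :=
    ((dκ.mul dr).mul (Decay.const (2⁻¹ : ℝ))).mul (dS.pow 2)
  refine ((((hT.add e1).add (e2.mono (by norm_num))).add (e3.mono (by norm_num))).sub e4).congr' ?_
  filter_upwards [Decay.eventually_snd_add_pos d0, Decay.eventually_snd_add_pos dΩ] with x h1 h2
  have h1' := h1.ne'
  have h2' := h2.ne'
  field_simp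
  ring

theorem hasDerivAt_clm_apply_complex {E : Type*} [NormedAddCommGroup E] [NormedSpace ℂ E]
    {U : ℝ → E →L[ℂ] E} {U' : E →L[ℂ] E} {f : ℝ → E} {f' : E} {s : ℝ}
    (hU : HasDerivAt U U' s) (hf : HasDerivAt f f' s) :
    HasDerivAt (fun t => U t (f t)) (U' (f s) + U s f') s :=
  ((ContinuousLinearMap.restrictScalarsL ℂ E E ℝ ℝ).hasFDerivAt.comp_hasDerivAt s hU).clm_apply hf

/-- Asymptotics of one component of the linear system `a′ = c(σa + Gb)`, `b′ = c(G*a − σb)`,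
`σ = s + m`, `c = ± i`, when `m` tends to `m₊` up to an oscillating remainder. -/
theorem decay_vector {ι : Type*} (G : H →L[ℂ] H) {c : ℂ} (hc : star c = -c)
    {a b : ι → ℝ → H} {m τ : ι → ℝ → ℝ} {τ' : ι × ℝ → ℝ} {mp : ι → ℝ} {B : ℝ}
    (ha : ∀ i s, HasDerivAt (a i) (c • (((s + m i s : ℝ) : ℂ) • a i s + G (b i s))) s)
    (hb : ∀ i s, HasDerivAt (b i)
      (c • (adjoint G (a i s) - ((s + m i s : ℝ) : ℂ) • b i s)) s)
    (haB : ∀ i s, ‖a i s‖ ≤ 1) (hbB : ∀ i s, ‖b i s‖ ≤ 1) (hmp : ∀ i, |mp i| ≤ B)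
    (hτB : ∀ i s, |τ i s| ≤ B) (hτ : ∀ i s, HasDerivAt (τ i) (τ' (i, s)) s)
    (hm : Decay 1 fun x : ι × ℝ => m x.1 x.2 - mp x.1)
    (hm2 : Decay 2 fun x : ι × ℝ =>
      m x.1 x.2 - mp x.1 - τ' x * ((x.2 + mp x.1)⁻¹ ^ 2 * 2⁻¹)) :
    ∃ ν : ι → H, (∀ i, Tendsto (fun s => ‖a i s‖) atTop (𝓝 ‖ν i‖)) ∧
      Decay 1 fun x : ι × ℝ =>
        a x.1 x.2 - phaseExp c (G * adjoint G) (x.2 + mp x.1) (ν x.1) := by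
  set A : H →L[ℂ] H := G * adjoint G with hAdef
  have hA : IsSelfAdjoint A := IsSelfAdjoint.mul_star_self G
  have hc' : star (-c) = - -c := by rw [star_neg, hc]
  let U : ι × ℝ → H →L[ℂ] H := fun x => phaseExp (-c) A (x.2 + mp x.1)
  have hU : ∀ x v, ‖U x v‖ = ‖v‖ := fun x v => norm_phaseExp_apply hc' hA _ v
  let w : ι × ℝ → H := fun x => U x (a x.1 x.2)
  let z : ι × ℝ → H := fun x => U x (G (b x.1 x.2))
  let S : ι × ℝ → ℂ := fun x => ((x.2 + mp x.1 : ℝ) : ℂ)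
  let d : ι × ℝ → ℂ := fun x => ((m x.1 x.2 - mp x.1 : ℝ) : ℂ)
  let w' : ι × ℝ → H := fun x => c • (d x • w x + z x - ((S x)⁻¹ * 2⁻¹) • U x (A (a x.1 x.2)))
  have dmp : Decay 0 fun x : ι × ℝ => mp x.1 := .of_bounded fun x => hmp x.1
  have dUa : Decay 0 fun x : ι × ℝ => U x (A (a x.1 x.2)) := by
    refine .of_bounded (C := ‖A‖) fun x => ?_
    rw [hU]
    exact A.unit_le_opNorm _ (haB _ _)
  have dw : Decay 0 w := .of_bounded (C := 1) fun x => by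
    simpa only [w, hU] using haB _ _
  have dz : Decay 0 z := .of_bounded (C := ‖G‖) fun x => by
    simpa only [z, hU] using G.unit_le_opNorm _ (hbB _ _)
  have dUb : Decay 0 fun x : ι × ℝ => U x (A (G (b x.1 x.2))) := by
    refine .of_bounded (C := ‖A * G‖) fun x => ?_
    rw [hU]
    exact (A * G).unit_le_opNorm _ (hbB _ _)
  have dS : Decay 1 fun x => (S x)⁻¹ := by
    refine (Decay.snd_add dmp).of_norm_le fun x => ?_
    simp only [S, ← Complex.ofReal_inv, Complex.norm_real]
    exact le_rfl
  have dd : Decay 1 d := hm.ofReal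
  have dτ : Decay 0 fun x : ι × ℝ => (τ x.1 x.2 : ℂ) :=
    (Decay.of_bounded (f := fun x : ι × ℝ => τ x.1 x.2) fun x => hτB x.1 x.2).ofReal
  have dw' : Decay 0 w' :=
    (Decay.const c).smul ((((dd.mono (by norm_num)).smul dw).add dz).sub
      (((dS.mono (Nat.zero_le _)).mul (Decay.const (2⁻¹ : ℂ))).smul dUa))
  have hUd : ∀ x : ι × ℝ, 0 < x.2 + mp x.1 → HasDerivAt (fun s => U (x.1, s))
      ((-c * S x) • U x + (-c * ((S x)⁻¹ * 2⁻¹)) • (U x * A)) x.2 := by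
    intro x hx
    have := (hasDerivAt_phaseExp (-c) A hx).scomp x.2
      ((hasDerivAt_id x.2).add_const (mp x.1))
    refine this.congr_deriv ?_
    rw [one_smul, mul_inv, Complex.ofReal_mul, mul_comm _ (((x.2 + mp x.1)⁻¹ : ℝ) : ℂ)]
    simp only [Complex.ofReal_inv, Complex.ofReal_ofNat, U, S]
  have hwd : ∀ x : ι × ℝ, 0 < x.2 + mp x.1 → HasDerivAt (fun s => w (x.1, s)) (w' x) x.2 := by
    intro x hx
    refine (hasDerivAt_clm_apply_complex (hUd x hx) (ha x.1 x.2)).congr_deriv ?_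
    simp only [w', w, z, S, d, _root_.add_apply, _root_.smul_apply, map_add, map_smul,
      mul_apply_eq_comp]
    push_cast
    module
  have hzd : ∀ x : ι × ℝ, 0 < x.2 + mp x.1 → HasDerivAt (fun s => z (x.1, s))
      (c • (-(2 * S x + d x) • z x + U x (A (a x.1 x.2))
        - ((S x)⁻¹ * 2⁻¹) • U x (A (G (b x.1 x.2))))) x.2 := by
    intro x hx
    have hGb : HasDerivAt (fun s => G (b x.1 s)) _ x.2 :=
      hasDerivAt_clm_apply_complex (hasDerivAt_const x.2 G) (hb x.1 x.2)
    refine (hasDerivAt_clm_apply_complex (hUd x hx) hGb).congr_deriv ?_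
    simp only [z, S, d, hAdef, _root_.add_apply, _root_.smul_apply, map_sub, map_smul,
      mul_apply_eq_comp, _root_.zero_apply, zero_add]
    push_cast
    module
  obtain ⟨ν, -, hν⟩ := Decay.exists_limit (k := 1) (ι := ι) one_ne_zero
    (F := fun x => w x + ((S x)⁻¹ * 2⁻¹) • z x
      - (c * τ x.1 x.2 * ((S x)⁻¹ ^ 2 * 2⁻¹)) • w x)
    (F' := fun x => (c * ((m x.1 x.2 - mp x.1 - τ' x * ((x.2 + mp x.1)⁻¹ ^ 2 * 2⁻¹) : ℝ) : ℂ)) • w x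
      - (c * d x * ((S x)⁻¹ * 2⁻¹)) • z x
      - (c * ((S x)⁻¹ ^ 2 * 4⁻¹)) • U x (A (G (b x.1 x.2)))
      - ((S x)⁻¹ ^ 2 * 2⁻¹) • z x
      - (c * τ x.1 x.2 * ((S x)⁻¹ ^ 2 * 2⁻¹)) • w' x
      + (c * τ x.1 x.2 * (S x)⁻¹ ^ 3) • w x)
    (by
      filter_upwards [Decay.eventually_snd_add_pos dmp] with x hx
      have hS0 : S x ≠ 0 := Complex.ofReal_ne_zero.2 hx.ne'
      have hSd : HasDerivAt (fun s => S (x.1, s)) 1 x.2 :=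
        ((hasDerivAt_id x.2).add_const (mp x.1)).ofReal_comp.congr_deriv (by simp)
      have hSi := hSd.fun_inv hS0
      have hτd := (hτ x.1 x.2).ofReal_comp
      refine (((hwd x hx).add ((hSi.mul_const 2⁻¹).smul (hzd x hx))).sub
        (((hτd.const_mul c).mul ((hSi.pow 2).mul_const 2⁻¹)).smul (hwd x hx))).congr_deriv ?_
      have hS1 : ((x.2 + mp x.1 : ℝ) : ℂ) = S x := rfl
      have hd1 : ((m x.1 x.2 - mp x.1 : ℝ) : ℂ) = d x := rfl
      rw [Complex.ofReal_sub _ (τ' x * _), hd1, Complex.ofReal_mul, Complex.ofReal_mul,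
        Complex.ofReal_pow, Complex.ofReal_inv, hS1]
      generalize hw1 : w' x = w1
      simp only [Pi.mul_apply, Pi.pow_apply, Nat.reduceSub, inv_pow]
      rw [← hw1]
      simp only [w']
      match_scalars <;> field_simp <;> ring)
    (by
      have k2 : Decay 0 fun _ : ι × ℝ => (2⁻¹ : ℂ) := Decay.const _
      have k4 : Decay 0 fun _ : ι × ℝ => (4⁻¹ : ℂ) := Decay.const _
      have kc : Decay 0 fun _ : ι × ℝ => c := Decay.const _
      have e1 := (kc.mul hm2.ofReal).smul dw
      have e2 := ((kc.mul dd).mul (dS.mul k2)).smul dz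
      have e3 := (kc.mul ((dS.pow 2).mul k4)).smul dUb
      have e4 := ((dS.pow 2).mul k2).smul dz
      have e5 := ((kc.mul dτ).mul ((dS.pow 2).mul k2)).smul dw'
      have e6 := ((kc.mul dτ).mul (dS.pow 3)).smul dw
      exact ((((e1.sub e2).sub e3).sub e4).sub e5).add (e6.mono (by norm_num)))
  have hwν : Decay 1 fun x => w x - ν x.1 := by
    have k2 : Decay 0 fun _ : ι × ℝ => (2⁻¹ : ℂ) := Decay.const _
    have kc : Decay 0 fun _ : ι × ℝ => c := Decay.const _
    have e1 := (dS.mul k2).smul dz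
    have e2 := ((kc.mul dτ).mul ((dS.pow 2).mul k2)).smul dw
    refine ((hν.sub e1).add (e2.mono (by norm_num))).congr' (Eventually.of_forall fun x => ?_)
    module
  refine ⟨ν, fun i => ?_, hwν.of_norm_le fun x => ?_⟩
  · have h := hwν.tendsto (k := 0) i
    have h2 : Tendsto (fun s => w (i, s)) atTop (𝓝 (ν i)) := by
      simpa using h.add_const (ν i)
    simpa only [w, hU] using h2.norm
  · rw [← hU x (a x.1 x.2 - _), map_sub]
    have : U x (phaseExp c A (x.2 + mp x.1) (ν x.1)) = ν x.1 := by
      have := phaseExp_mul_phaseExp_neg (-c) A (x.2 + mp x.1)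
      rw [neg_neg] at this
      exact congrArg (fun T : H →L[ℂ] H => T (ν x.1)) this
    rw [this]

/-- The scalar-gauged Landau-Zener system `v₁′ = i(σv₁ + Gv₂)`, `v₂′ = i(G*v₁ − σv₂)` with
`σ(s) = s + g(‖v₁(s)‖²)`, on the unit sphere. -/
structure IsGaugedSol (G : H →L[ℂ] H) (g : ℝ → ℝ) (a b : ℝ → H) : Prop where
  deriv_fst : ∀ s, HasDerivAt a
    (Complex.I • (((s + g (‖a s‖ ^ 2) : ℝ) : ℂ) • a s + G (b s))) s
  deriv_snd : ∀ s, HasDerivAt b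
    (Complex.I • (adjoint G (a s) - ((s + g (‖a s‖ ^ 2) : ℝ) : ℂ) • b s)) s
  norm_sq : ∀ s, ‖a s‖ ^ 2 + ‖b s‖ ^ 2 = 1

namespace IsGaugedSol

variable {G : H →L[ℂ] H} {g : ℝ → ℝ} {a b : ℝ → H}

theorem norm_fst_le (h : IsGaugedSol G g a b) (s : ℝ) : ‖a s‖ ≤ 1 := by
  nlinarith [h.norm_sq s, norm_nonneg (a s), sq_nonneg ‖b s‖]

theorem norm_snd_le (h : IsGaugedSol G g a b) (s : ℝ) : ‖b s‖ ≤ 1 := by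
  nlinarith [h.norm_sq s, norm_nonneg (b s), sq_nonneg ‖a s‖]

theorem hasDerivAt_normSq (h : IsGaugedSol G g a b) (s : ℝ) :
    HasDerivAt (fun s => ‖a s‖ ^ 2) (-2 * (⟪a s, G (b s)⟫_ℂ).im) s := by
  have h1 := (h.deriv_fst s).inner ℂ (h.deriv_fst s)
  have h2 := Complex.reCLM.hasFDerivAt.comp_hasDerivAt s h1
  have e : (fun s => ‖a s‖ ^ 2) = Complex.reCLM ∘ fun s => ⟪a s, a s⟫_ℂ := by
    funext t
    simp only [Function.comp, Complex.reCLM_apply]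
    exact (inner_self_eq_norm_sq (𝕜 := ℂ) (a t)).symm
  rw [e]
  refine h2.congr_deriv ?_
  have e2 : (⟪G (b s), a s⟫_ℂ).im = -(⟪a s, G (b s)⟫_ℂ).im := by
    rw [← inner_conj_symm, Complex.conj_im]
  rw [inner_smul_left, inner_smul_right, inner_add_left, inner_add_right, inner_smul_left,
    inner_smul_right]
  simp
  rw [e2]
  ring

theorem hasDerivAt_inner (h : IsGaugedSol G g a b) (s : ℝ) :
    HasDerivAt (fun s => ⟪a s, G (b s)⟫_ℂ)
      (-2 * Complex.I * ((s + g (‖a s‖ ^ 2) : ℝ) : ℂ) * ⟪a s, G (b s)⟫_ℂ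
        + Complex.I * ((‖adjoint G (a s)‖ ^ 2 - ‖G (b s)‖ ^ 2 : ℝ) : ℂ)) s := by
  have hGb : HasDerivAt (fun s => G (b s)) _ s :=
    hasDerivAt_clm_apply_complex (hasDerivAt_const s G) (h.deriv_snd s)
  refine ((h.deriv_fst s).inner ℂ hGb).congr_deriv ?_
  have e1 : ⟪G (b s), G (b s)⟫_ℂ = ((‖G (b s)‖ ^ 2 : ℝ) : ℂ) := by
    rw [inner_self_eq_norm_sq_to_K]; push_cast; rfl
  have e2 : ⟪a s, G (adjoint G (a s))⟫_ℂ = ((‖adjoint G (a s)‖ ^ 2 : ℝ) : ℂ) := by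
    rw [← adjoint_inner_left, inner_self_eq_norm_sq_to_K]; push_cast; rfl
  rw [_root_.zero_apply, zero_add, map_smul, map_sub, map_smul, inner_smul_left, inner_smul_right,
    inner_add_left, inner_sub_right, inner_smul_left, inner_smul_right, e1, e2]
  simp only [Complex.conj_I, Complex.conj_ofReal]
  push_cast
  ring

end IsGaugedSol

/-- Uniform asymptotics at `+∞` for the gauged Landau-Zener system. -/
theorem IsGaugedSol.exists_asymptotics (G : H →L[ℂ] H) {g : ℝ → ℝ} (hg : ContDiff ℝ 2 g) :
    ∃ C > 0, ∃ s₀ ≥ 1, ∀ (a b : ℝ → H) (Ω : ℝ), IsGaugedSol G g a b →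
      Tendsto (fun s => ‖a s‖ ^ 2) atTop (𝓝 Ω) →
      ∃ ν₁ ν₂ : H, ‖ν₁‖ ^ 2 = Ω ∧ ‖ν₂‖ ^ 2 = 1 - Ω ∧ ∀ s ≥ s₀,
        ‖a s - phaseExp Complex.I (G * adjoint G) (s + g Ω) ν₁‖ ≤ C / s ∧
        ‖b s - phaseExp (-Complex.I) (adjoint G * G) (s + g Ω) ν₂‖ ≤ C / s := by
  let J := {x : (ℝ → H) × (ℝ → H) × ℝ // IsGaugedSol G g x.1 x.2.1 ∧
    Tendsto (fun s => ‖x.1 s‖ ^ 2) atTop (𝓝 x.2.2)}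
  let a : J → ℝ → H := fun i => i.1.1
  let b : J → ℝ → H := fun i => i.1.2.1
  let Ω : J → ℝ := fun i => i.1.2.2
  have hs : ∀ i : J, IsGaugedSol G g (a i) (b i) := fun i => i.2.1
  have hq : ∀ i s, ‖⟪a i s, G (b i s)⟫_ℂ‖ ≤ ‖G‖ := fun i s => by
    refine (norm_inner_le_norm _ _).trans ?_
    calc ‖a i s‖ * ‖G (b i s)‖ ≤ 1 * ‖G‖ := by
          gcongr
          · exact (hs i).norm_fst_le s
          · exact G.unit_le_opNorm _ ((hs i).norm_snd_le s)
      _ = ‖G‖ := one_mul _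
  have hr : ∀ i s, |‖adjoint G (a i s)‖ ^ 2 - ‖G (b i s)‖ ^ 2| ≤ ‖G‖ ^ 2 := fun i s => by
    have h1 : ‖adjoint G (a i s)‖ ≤ ‖G‖ := by
      rw [← LinearIsometryEquiv.norm_map adjoint G]
      exact (adjoint G).unit_le_opNorm _ ((hs i).norm_fst_le s)
    have h2 : ‖G (b i s)‖ ≤ ‖G‖ := G.unit_le_opNorm _ ((hs i).norm_snd_le s)
    have h1' := pow_le_pow_left₀ (norm_nonneg _) h1 2
    have h2' := pow_le_pow_left₀ (norm_nonneg _) h2 2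
    rw [abs_le]
    constructor <;> nlinarith [sq_nonneg ‖adjoint G (a i s)‖, sq_nonneg ‖G (b i s)‖]
  have hX : ∀ i s, HasDerivAt (fun s => (⟪a i s, G (b i s)⟫_ℂ).re)
      (2 * (s + g (‖a i s‖ ^ 2)) * (⟪a i s, G (b i s)⟫_ℂ).im) s := fun i s => by
    refine (Complex.reCLM.hasFDerivAt.comp_hasDerivAt s ((hs i).hasDerivAt_inner s)).congr_deriv ?_
    simp only [Complex.reCLM_apply, Complex.add_re, Complex.mul_re, Complex.mul_im, Complex.I_re,
      Complex.I_im, Complex.ofReal_re, Complex.ofReal_im, Complex.neg_re, Complex.neg_im,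
      Complex.re_ofNat, Complex.im_ofNat]
    ring
  have hY : ∀ i s, HasDerivAt (fun s => (⟪a i s, G (b i s)⟫_ℂ).im)
      (-2 * (s + g (‖a i s‖ ^ 2)) * (⟪a i s, G (b i s)⟫_ℂ).re +
        (‖adjoint G (a i s)‖ ^ 2 - ‖G (b i s)‖ ^ 2)) s := fun i s => by
    refine (Complex.imCLM.hasFDerivAt.comp_hasDerivAt s ((hs i).hasDerivAt_inner s)).congr_deriv ?_
    simp only [Complex.imCLM_apply, Complex.add_im, Complex.mul_re, Complex.mul_im, Complex.I_re,
      Complex.I_im, Complex.ofReal_re, Complex.ofReal_im, Complex.neg_re, Complex.neg_im,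
      Complex.re_ofNat, Complex.im_ofNat]
    ring
  obtain ⟨⟨B₀, hB₀⟩, ⟨B₁, hB₁⟩, hd, hd2⟩ := decay_scalar (ι := J) hg (Ω := Ω)
    (C := max ‖G‖ (‖G‖ ^ 2))
    (fun i s => (hs i).hasDerivAt_normSq s) hX hY
    (fun i s => ⟨by positivity, by nlinarith [(hs i).norm_sq s, sq_nonneg ‖b i s‖]⟩)
    (fun i s => ((Complex.abs_re_le_norm _).trans (hq i s)).trans (le_max_left _ _))
    (fun i s => ((Complex.abs_im_le_norm _).trans (hq i s)).trans (le_max_left _ _))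
    (fun i s => (hr i s).trans (le_max_right _ _))
    (fun i => i.2.2)
  have hτB : ∀ i s, |deriv g (Ω i) * (⟪a i s, G (b i s)⟫_ℂ).im| ≤ max B₀ (B₁ * ‖G‖) := fun i s => by
    rw [abs_mul]
    refine le_trans ?_ (le_max_right _ _)
    exact mul_le_mul (hB₁ i) ((Complex.abs_im_le_norm _).trans (hq i s)) (abs_nonneg _)
      ((abs_nonneg _).trans (hB₁ i))
  obtain ⟨ν₁, hν₁, hν₁'⟩ := decay_vector (ι := J) G (c := Complex.I) (by simp)
    (m := fun i s => g (‖a i s‖ ^ 2)) (mp := fun i => g (Ω i))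
    (fun i s => (hs i).deriv_fst s) (fun i s => (hs i).deriv_snd s)
    (fun i s => (hs i).norm_fst_le s) (fun i s => (hs i).norm_snd_le s)
    (fun i => (hB₀ i).trans (le_max_left _ _)) hτB
    (fun i s => (hY i s).const_mul (deriv g (Ω i))) hd hd2
  obtain ⟨ν₂, hν₂, hν₂'⟩ := decay_vector (ι := J) (-adjoint G) (c := -Complex.I) (by simp)
    (a := b) (b := a)
    (m := fun i s => g (‖a i s‖ ^ 2)) (mp := fun i => g (Ω i))
    (fun i s => ((hs i).deriv_snd s).congr_deriv (by rw [_root_.neg_apply]; module))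
    (fun i s => ((hs i).deriv_fst s).congr_deriv (by
      rw [map_neg, adjoint_adjoint, _root_.neg_apply]; module))
    (fun i s => (hs i).norm_snd_le s) (fun i s => (hs i).norm_fst_le s)
    (fun i => (hB₀ i).trans (le_max_left _ _)) hτB
    (fun i s => (hY i s).const_mul (deriv g (Ω i))) hd hd2
  have hGG : -adjoint G * adjoint (-adjoint G) = adjoint G * G := by
    rw [map_neg, adjoint_adjoint, neg_mul_neg]
  rw [hGG] at hν₂'
  obtain ⟨C₁, hC₁, s₁, hs₁, h₁⟩ := hν₁'.exists_bound
  obtain ⟨C₂, hC₂, s₂, hs₂, h₂⟩ := hν₂'.exists_bound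
  refine ⟨max C₁ C₂, lt_max_of_lt_left hC₁, max s₁ s₂, le_max_of_le_left hs₁,
    fun a' b' Ω' h' hΩ' => ?_⟩
  let i : J := ⟨(a', b', Ω'), h', hΩ'⟩
  refine ⟨ν₁ i, ν₂ i, tendsto_nhds_unique ((hν₁ i).pow 2) hΩ',
    tendsto_nhds_unique ((hν₂ i).pow 2) ?_, fun s hs' => ⟨?_, ?_⟩⟩
  · refine (hΩ'.const_sub 1).congr fun s => ?_
    rw [← h'.norm_sq s]
    exact add_sub_cancel_left _ _
  · refine (h₁ i s ((le_max_left _ _).trans hs')).trans ?_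
    have : 0 < s := by linarith [(le_max_left s₁ s₂).trans hs']
    rw [pow_one, ← div_eq_mul_inv]
    gcongr
    exact le_max_left _ _
  · refine (h₂ i s ((le_max_right _ _).trans hs')).trans ?_
    have : 0 < s := by linarith [(le_max_left s₁ s₂).trans hs']
    rw [pow_one, ← div_eq_mul_inv]
    gcongr
    exact le_max_right _ _

theorem phaseExp_neg (c : ℂ) (A : H →L[ℂ] H) (s : ℝ) : phaseExp c A (-s) = phaseExp c A s := by
  simp [phaseExp, Real.log_neg_eq_log]

theorem ePhaseP_eq_phaseExp (G : H →L[ℂ] H) (s : ℝ) :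
    ePhaseP G s = phaseExp Complex.I (G * adjoint G) s :=
  fc_exp_phase _ (IsSelfAdjoint.mul_star_self G) s

theorem ePhaseM_eq_phaseExp (G : H →L[ℂ] H) (s : ℝ) :
    ePhaseM G s = phaseExp (-Complex.I) (adjoint G * G) s := by
  simp only [ePhaseM, ← neg_mul]
  exact fc_exp_phase _ (IsSelfAdjoint.star_mul_self G) s

/-- The gauged Landau-Zener system is invariant under `s ↦ -s`, `v₂ ↦ -v₂`, `g ↦ -g`. -/
theorem IsGaugedSol.reverse {G : H →L[ℂ] H} {g : ℝ → ℝ} {a b : ℝ → H}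
    (h : IsGaugedSol G g a b) :
    IsGaugedSol G (fun x => -g x) (fun s => a (-s)) (fun s => -b (-s)) where
  deriv_fst s := by
    refine ((h.deriv_fst (-s)).scomp s (hasDerivAt_neg s)).congr_deriv ?_
    rw [map_neg]
    push_cast
    module
  deriv_snd s := by
    refine ((h.deriv_snd (-s)).scomp s (hasDerivAt_neg s)).fun_neg.congr_deriv ?_
    push_cast
    module
  norm_sq s := by rw [norm_neg]; exact h.norm_sq (-s)

theorem norm_sq_add_norm_sq_eq {G : H →L[ℂ] H} {σ : ℝ → ℝ} {a b : ℝ → H}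
    (ha : ∀ s, HasDerivAt a (Complex.I • ((σ s : ℂ) • a s + G (b s))) s)
    (hb : ∀ s, HasDerivAt b (Complex.I • (adjoint G (a s) - (σ s : ℂ) • b s)) s) (s : ℝ) :
    ‖a s‖ ^ 2 + ‖b s‖ ^ 2 = ‖a 0‖ ^ 2 + ‖b 0‖ ^ 2 := by
  have hd : ∀ s, HasDerivAt (fun s => ⟪a s, a s⟫_ℂ + ⟪b s, b s⟫_ℂ) 0 s := fun s => by
    refine (((ha s).inner ℂ (ha s)).add ((hb s).inner ℂ (hb s))).congr_deriv ?_
    simp only [inner_smul_left, inner_smul_right, inner_add_left, inner_add_right,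
      inner_sub_left, inner_sub_right, adjoint_inner_left, adjoint_inner_right,
      Complex.conj_I, Complex.conj_ofReal]
    ring
  have h := is_const_of_deriv_eq_zero (fun s => (hd s).differentiableAt)
    (fun s => (hd s).deriv) s 0
  simp only [inner_self_eq_norm_sq_to_K] at h
  exact_mod_cast h

namespace IsLZSol

variable {G : H →L[ℂ] H} {δ : ℝ} {f₁ f₂ : ℝ × ℝ → ℝ} {u : ℝ → WithLp 2 (H × H)}

theorem hasDerivAt_fst (h : IsLZSol G δ f₁ f₂ u) (s : ℝ) :
    HasDerivAt (fun s => (u s).fst) (Complex.I • ((s : ℂ) • (u s).fst + G (u s).snd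
      + δ • F1 f₁ (u s) • (u s).fst)) s :=
  ((((eqv (H := H)).toContinuousLinearMap.restrictScalars ℝ).hasFDerivAt.comp_hasDerivAt s
    (h s))).fst

theorem hasDerivAt_snd (h : IsLZSol G δ f₁ f₂ u) (s : ℝ) :
    HasDerivAt (fun s => (u s).snd) (Complex.I • (adjoint G (u s).fst - (s : ℂ) • (u s).snd
      + δ • F2 f₂ (u s) • (u s).snd)) s :=
  ((((eqv (H := H)).toContinuousLinearMap.restrictScalars ℝ).hasFDerivAt.comp_hasDerivAt s
    (h s))).snd

theorem hasDerivAt_gauge (h : IsLZSol G δ f₁ f₂ u) (hf₁ : Continuous f₁) (hf₂ : Continuous f₂)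
    (s : ℝ) :
    HasDerivAt (fun s : ℝ => Complex.exp (-(Complex.I * (∫ τ in (0:ℝ)..s, Mscal δ f₁ f₂ (u τ)))))
      (Complex.exp (-(Complex.I * (∫ τ in (0:ℝ)..s, Mscal δ f₁ f₂ (u τ))))
        * -(Complex.I * Mscal δ f₁ f₂ (u s))) s := by
  have h1 : Continuous fun s => (u s).fst :=
    continuous_iff_continuousAt.2 fun s => (h.hasDerivAt_fst s).continuousAt
  have h2 : Continuous fun s => (u s).snd :=
    continuous_iff_continuousAt.2 fun s => (h.hasDerivAt_snd s).continuousAt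
  have hM : Continuous fun s => Mscal δ f₁ f₂ (u s) := by
    unfold Mscal F1 F2
    fun_prop
  exact ((hM.integral_hasStrictDerivAt 0 s).hasDerivAt.ofReal_comp.const_mul
    Complex.I).fun_neg.cexp

end IsLZSol

theorem norm_exp_neg_I_mul_ofReal (x : ℝ) : ‖Complex.exp (-(Complex.I * x))‖ = 1 := by
  simp [Complex.norm_exp]

theorem norm_gaugeT_fst {E : Type*} [NormedAddCommGroup E] [InnerProductSpace ℂ E]
    (δ : ℝ) (f₁ f₂ : ℝ × ℝ → ℝ) (u : ℝ → WithLp 2 (E × E)) (s : ℝ) :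
    ‖(gaugeT δ f₁ f₂ u s).fst‖ = ‖(u s).fst‖ := by
  rw [gaugeT, WithLp.smul_fst, norm_smul, norm_exp_neg_I_mul_ofReal, one_mul]

theorem norm_gaugeT_snd {E : Type*} [NormedAddCommGroup E] [InnerProductSpace ℂ E]
    (δ : ℝ) (f₁ f₂ : ℝ × ℝ → ℝ) (u : ℝ → WithLp 2 (E × E)) (s : ℝ) :
    ‖(gaugeT δ f₁ f₂ u s).snd‖ = ‖(u s).snd‖ := by
  rw [gaugeT, WithLp.smul_snd, norm_smul, norm_exp_neg_I_mul_ofReal, one_mul]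

theorem IsLZSol.isGaugedSol {G : H →L[ℂ] H} {δ : ℝ} {f₁ f₂ : ℝ × ℝ → ℝ}
    {u : ℝ → WithLp 2 (H × H)} (h : IsLZSol G δ f₁ f₂ u) (hf₁ : Continuous f₁)
    (hf₂ : Continuous f₂) (h0 : ‖(u 0).fst‖ ^ 2 + ‖(u 0).snd‖ ^ 2 = 1) :
    IsGaugedSol G (fun x => mtilde δ f₁ f₂ (x, 1 - x))
      (fun s => (gaugeT δ f₁ f₂ u s).fst) (fun s => (gaugeT δ f₁ f₂ u s).snd) := by
  have ha : ∀ s, HasDerivAt (fun s => (gaugeT δ f₁ f₂ u s).fst)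
      (Complex.I • (((s + mscal δ f₁ f₂ (u s) : ℝ) : ℂ) • (gaugeT δ f₁ f₂ u s).fst
        + G (gaugeT δ f₁ f₂ u s).snd)) s := fun s => by
    refine ((h.hasDerivAt_gauge hf₁ hf₂ s).smul (h.hasDerivAt_fst s)).congr_deriv ?_
    simp only [gaugeT, WithLp.smul_fst, WithLp.smul_snd, map_smul, mscal, Mscal,
      ← Complex.coe_smul]
    push_cast
    module
  have hb : ∀ s, HasDerivAt (fun s => (gaugeT δ f₁ f₂ u s).snd)
      (Complex.I • (adjoint G (gaugeT δ f₁ f₂ u s).fst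
        - ((s + mscal δ f₁ f₂ (u s) : ℝ) : ℂ) • (gaugeT δ f₁ f₂ u s).snd)) s := fun s => by
    refine ((h.hasDerivAt_gauge hf₁ hf₂ s).smul (h.hasDerivAt_snd s)).congr_deriv ?_
    simp only [gaugeT, WithLp.smul_fst, WithLp.smul_snd, map_smul, mscal, Mscal,
      ← Complex.coe_smul]
    push_cast
    module
  have hn : ∀ s, ‖(gaugeT δ f₁ f₂ u s).fst‖ ^ 2 + ‖(gaugeT δ f₁ f₂ u s).snd‖ ^ 2 = 1 := by
    intro s
    rw [norm_sq_add_norm_sq_eq ha hb s, norm_gaugeT_fst, norm_gaugeT_snd, h0]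
  have hm : ∀ s, mtilde δ f₁ f₂ (‖(gaugeT δ f₁ f₂ u s).fst‖ ^ 2,
      1 - ‖(gaugeT δ f₁ f₂ u s).fst‖ ^ 2) = mscal δ f₁ f₂ (u s) := fun s => by
    rw [← hn s, add_sub_cancel_left, norm_gaugeT_fst, norm_gaugeT_snd]
    rfl
  exact ⟨fun s => by simpa only [hm] using ha s, fun s => by simpa only [hm] using hb s, hn⟩

/-- asymptotics of the gauge-transformed solution `v`
(Proposition 2.2). Here `m₊ = m̃(Ω₁,Ω₂)` and `m₋ = m̃(A₁,A₂)` with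
`m̃ = (δ/2)(f₁ − f₂)`. -/
theorem stmt_8 {K : Type*} [NormedAddCommGroup K] [InnerProductSpace ℂ K]
    [FiniteDimensional ℂ K]
    (G : K →L[ℂ] K) (hG : CommHyp G) (hGu : IsUnit G) (δ : ℝ) (f₁ f₂ : ℝ × ℝ → ℝ)
    (hf₁ : C2Bdd f₁) (hf₂ : C2Bdd f₂) (θ : ℝ → ℝ) (hθ : IsCutoff θ)
    (R : ℝ) (hR : 0 < R) :
    ∃ C > 0, ∀ u₀ : WithLp 2 (K × K), ∀ u : ℝ → WithLp 2 (K × K),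
      Theta G θ R u₀ = u₀ → ‖u₀.fst‖ ^ 2 + ‖u₀.snd‖ ^ 2 = 1 →
      IsLZSol G δ f₁ f₂ u → u 0 = u₀ →
      ∀ Ω₁ Ω₂ A₁ A₂ : ℝ,
        Tendsto (fun s : ℝ => ‖(u s).fst‖ ^ 2) atTop (𝓝 Ω₁) →
        Tendsto (fun s : ℝ => ‖(u s).snd‖ ^ 2) atTop (𝓝 Ω₂) →
        Tendsto (fun s : ℝ => ‖(u s).fst‖ ^ 2) atBot (𝓝 A₁) →
        Tendsto (fun s : ℝ => ‖(u s).snd‖ ^ 2) atBot (𝓝 A₂) →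
        ∃ ν μ : WithLp 2 (K × K),
          ‖ν.fst‖ ^ 2 = Ω₁ ∧ ‖ν.snd‖ ^ 2 = Ω₂ ∧ ‖μ.fst‖ ^ 2 = A₁ ∧ ‖μ.snd‖ ^ 2 = A₂ ∧
          ∃ s₀ : ℝ, 1 ≤ s₀ ∧
            (∀ s : ℝ, s₀ ≤ s →
              ‖(gaugeT δ f₁ f₂ u s).fst
                - ePhaseP G (s + mtilde δ f₁ f₂ (Ω₁, Ω₂)) ν.fst‖ ≤ C / s ∧
              ‖(gaugeT δ f₁ f₂ u s).snd
                - ePhaseM G (s + mtilde δ f₁ f₂ (Ω₁, Ω₂)) ν.snd‖ ≤ C / s) ∧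
            (∀ s : ℝ, s ≤ -s₀ →
              ‖(gaugeT δ f₁ f₂ u s).fst
                - ePhaseP G (s + mtilde δ f₁ f₂ (A₁, A₂)) μ.fst‖ ≤ C / |s| ∧
              ‖(gaugeT δ f₁ f₂ u s).snd
                - ePhaseM G (s + mtilde δ f₁ f₂ (A₁, A₂)) μ.snd‖ ≤ C / |s|) := by
  have hg : ContDiff ℝ 2 fun x : ℝ => mtilde δ f₁ f₂ (x, 1 - x) := by
    have h₁ := hf₁.1
    have h₂ := hf₂.1
    unfold mtilde
    fun_prop
  obtain ⟨Cp, hCp, sp, hsp, hp⟩ := IsGaugedSol.exists_asymptotics G hg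
  obtain ⟨Cm, hCm, sm, hsm, hm⟩ := IsGaugedSol.exists_asymptotics G hg.neg
  refine ⟨max Cp Cm, lt_max_of_lt_left hCp, ?_⟩
  rintro _ u - h0 hu rfl Ω₁ Ω₂ A₁ A₂ hΩ₁ hΩ₂ hA₁ hA₂
  have hsol := hu.isGaugedSol hf₁.1.continuous hf₂.1.continuous h0
  have hsum : ∀ s, ‖(u s).snd‖ ^ 2 = 1 - ‖(u s).fst‖ ^ 2 := fun s => by
    have := hsol.norm_sq s
    rw [norm_gaugeT_fst, norm_gaugeT_snd] at this
    linarith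
  simp only [hsum] at hΩ₂ hA₂
  obtain rfl := tendsto_nhds_unique hΩ₂ (hΩ₁.const_sub 1)
  obtain rfl := tendsto_nhds_unique hA₂ (hA₁.const_sub 1)
  obtain ⟨ν₁, ν₂, hν₁, hν₂, hν⟩ := hp _ _ Ω₁ hsol (by simpa only [norm_gaugeT_fst] using hΩ₁)
  obtain ⟨μ₁, μ₂, hμ₁, hμ₂, hμ⟩ := hm _ _ A₁ hsol.reverse
    (by simp only [norm_gaugeT_fst]; exact hA₁.comp tendsto_neg_atTop_atBot)
  refine ⟨WithLp.toLp 2 (ν₁, ν₂), WithLp.toLp 2 (μ₁, -μ₂), hν₁, hν₂, hμ₁,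
    by simpa using hμ₂, max sp sm, le_max_of_le_left hsp, fun s hs => ?_, fun s hs => ?_⟩
  · have hs' := (le_max_left _ _).trans hs
    have hs0 : 0 < s := by linarith
    have hC : Cp / s ≤ max Cp Cm / s := by gcongr; exact le_max_left _ _
    rw [ePhaseP_eq_phaseExp, ePhaseM_eq_phaseExp]
    exact ⟨(hν s hs').1.trans hC, (hν s hs').2.trans hC⟩
  · have hs' : sm ≤ -s := (le_max_right sp sm).trans (le_neg_of_le_neg hs)
    have hs0 : 0 < -s := by linarith
    have hC : Cm / -s ≤ max Cp Cm / |s| := by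
      rw [abs_of_neg (neg_pos.1 hs0)]
      gcongr
      exact le_max_right _ _
    have hb := hμ (-s) hs'
    simp only [neg_neg, ← neg_add, phaseExp_neg] at hb
    rw [ePhaseP_eq_phaseExp, ePhaseM_eq_phaseExp]
    refine ⟨hb.1.trans hC, le_trans (le_of_eq ?_) (hb.2.trans hC)⟩
    change ‖_ - phaseExp _ _ _ (-μ₂)‖ = _
    rw [map_neg, ← norm_neg]
    congr 1
    abel

end
end

section
/- For continuous functions a, b, c, d : ℝ → ℂ let A(a,b,c,d) be the bounded operator on 𝓗² given by A(a,b,c,d)(w₁,w₂) = (a(GG*)w₁ + b(GG*)Gw₂, c(G*G)G*w₁ + d(G*G)w₂). Then: (i) the adjoint satisfies A(a,b,c,d)* = A(ā, c̄, b̄, d̄), where ā denotes the complex conjugate function; (ii) for continuous a′, b′, c′, d′ : ℝ → ℂ one has the composition formula A(a,b,c,d) ∘ A(a′,b′,c′,d′) = A(a″,b″,c″,d″) with a″(λ) = a(λ)a′(λ) + λ·b(λ)c′(λ), b″(λ) = a(λ)b′(λ) + b(λ)d′(λ), c″(λ) = a′(λ)c(λ) + d(λ)c′(λ), and d″(λ)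 = d(λ)d′(λ) + λ·c(λ)b′(λ). -/
open ContinuousLinearMap Complex Filter Topology
open scoped InnerProductSpace

noncomputable section

variable {H : Type*} [NormedAddCommGroup H] [InnerProductSpace ℂ H] [CompleteSpace H]

theorem fc_add {χ ψ : ℝ → ℂ} (hχ : Continuous χ) (hψ : Continuous ψ) (A : H →L[ℂ] H) :
    fc (fun x => χ x + ψ x) A = fc χ A + fc ψ A := by
  simp only [fc, add_re, add_im]
  rw [cfc_add (a := A) (fun x => (χ x).re) (fun x => (ψ x).re),
    cfc_add (a := A) (fun x => (χ x).im) (fun x => (ψ x).im)]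
  module

theorem fc_mul {χ ψ : ℝ → ℂ} (hχ : Continuous χ) (hψ : Continuous ψ) (A : H →L[ℂ] H) :
    fc (fun x => χ x * ψ x) A = fc χ A * fc ψ A := by
  simp only [fc, mul_re, mul_im]
  rw [cfc_sub (a := A) (fun x => (χ x).re * (ψ x).re) (fun x => (χ x).im * (ψ x).im),
    cfc_add (a := A) (fun x => (χ x).re * (ψ x).im) (fun x => (χ x).im * (ψ x).re),
    cfc_mul (fun x => (χ x).re) (fun x => (ψ x).re) A,
    cfc_mul (fun x => (χ x).im) (fun x => (ψ x).im) A,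
    cfc_mul (fun x => (χ x).re) (fun x => (ψ x).im) A,
    cfc_mul (fun x => (χ x).im) (fun x => (ψ x).re) A]
  simp only [mul_add, add_mul, smul_mul_assoc, mul_smul_comm, smul_add, smul_smul, I_mul_I]
  module

theorem fc_ofReal {A : H →L[ℂ] H} (hA : IsSelfAdjoint A) :
    fc (fun x => (x : ℂ)) A = A := by
  simp [fc, cfc_id' ℝ A]

theorem adjoint_fc (χ : ℝ → ℂ) (A : H →L[ℂ] H) :
    adjoint (fc χ A) = fc (fun x => starRingEnd ℂ (χ x)) A := by
  have h (f : ℝ → ℝ) : star (cfc f A) = cfc f A := cfc_predicate f A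
  simp only [← star_eq_adjoint, fc, star_add, star_smul, h, conj_re, conj_im, cfc_neg]
  simp

theorem fc_mul_ofReal_mul {χ ψ : ℝ → ℂ} (hχ : Continuous χ) (hψ : Continuous ψ)
    {A : H →L[ℂ] H} (hA : IsSelfAdjoint A) :
    fc (fun x => (x : ℂ) * (χ x * ψ x)) A = fc χ A * fc ψ A * A := by
  have h : (fun x : ℝ => (x : ℂ) * (χ x * ψ x)) = fun x => χ x * ψ x * (x : ℂ) :=
    funext fun x => mul_comm _ _
  rw [h, fc_mul (hχ.fun_mul hψ) continuous_ofReal, fc_mul hχ hψ, fc_ofReal hA]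

@[simp]
theorem Aop_apply_fst (G : H →L[ℂ] H) (a b c d : ℝ → ℂ) (w : WithLp 2 (H × H)) :
    (Aop G a b c d w).fst = fc a (G * adjoint G) w.fst + fc b (G * adjoint G) (G w.snd) :=
  rfl

@[simp]
theorem Aop_apply_snd (G : H →L[ℂ] H) (a b c d : ℝ → ℂ) (w : WithLp 2 (H × H)) :
    (Aop G a b c d w).snd =
      fc c (adjoint G * G) (adjoint G w.fst) + fc d (adjoint G * G) w.snd :=
  rfl

namespace CommHyp

variable {G : H →L[ℂ] H} {χ : ℝ → ℂ}

theorem fc_apply (hG : CommHyp G) (hχ : Continuous χ) (w : H) :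
    fc χ (G * adjoint G) (G w) = G (fc χ (adjoint G * G) w) :=
  DFunLike.congr_fun (hG χ hχ).1 w

theorem fc_adjoint_apply (hG : CommHyp G) (hχ : Continuous χ) (w : H) :
    fc χ (adjoint G * G) (adjoint G w) = adjoint G (fc χ (G * adjoint G) w) :=
  DFunLike.congr_fun (hG χ hχ).2 w

theorem adjoint_Aop (hG : CommHyp G) {b c : ℝ → ℂ}
    (hb : Continuous b) (hc : Continuous c) (a d : ℝ → ℂ) :
    adjoint (Aop G a b c d)
      = Aop G (fun lam => starRingEnd ℂ (a lam)) (fun lam => starRingEnd ℂ (c lam))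
          (fun lam => starRingEnd ℂ (b lam)) (fun lam => starRingEnd ℂ (d lam)) := by
  refine ((eq_adjoint_iff _ _).2 fun x y => ?_).symm
  simp only [WithLp.prod_inner_apply, WithLp.ofLp_fst, WithLp.ofLp_snd, Aop_apply_fst,
    Aop_apply_snd, inner_add_left, inner_add_right, ← adjoint_fc, adjoint_inner_left,
    adjoint_inner_right, hG.fc_apply hb, hG.fc_adjoint_apply hc]
  ring

theorem Aop_comp_Aop (hG : CommHyp G) {a b c d a' b' c' d' : ℝ → ℂ}
    (ha : Continuous a) (hb : Continuous b) (hc : Continuous c) (hd : Continuous d)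
    (ha' : Continuous a') (hb' : Continuous b') (hc' : Continuous c')
    (hd' : Continuous d') :
    (Aop G a b c d) ∘L (Aop G a' b' c' d')
      = Aop G (fun lam => a lam * a' lam + (lam : ℂ) * (b lam * c' lam))
          (fun lam => a lam * b' lam + b lam * d' lam)
          (fun lam => a' lam * c lam + d lam * c' lam)
          (fun lam => d lam * d' lam + (lam : ℂ) * (c lam * b' lam)) := by
  have hP : IsSelfAdjoint (G * adjoint G) := .mul_star_self G
  have hM : IsSelfAdjoint (adjoint G * G) := .star_mul_self G
  have hac (A : H →L[ℂ] H) : fc (fun lam => a' lam * c lam) A = fc c A * fc a' A := by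
    simp only [mul_comm (a' _), fc_mul hc ha']
  ext w
  refine (WithLp.ofLp_injective 2) (Prod.ext ?_ ?_)
  · simp only [comp_apply, WithLp.ofLp_fst, Aop_apply_fst, Aop_apply_snd]
    rw [fc_add (ha.fun_mul ha') (continuous_ofReal.fun_mul (hb.fun_mul hc')),
      fc_add (ha.fun_mul hb') (hb.fun_mul hd'), fc_mul_ofReal_mul hb hc' hP,
      fc_mul ha ha', fc_mul ha hb', fc_mul hb hd']
    simp only [add_apply, mul_apply_eq_comp, map_add, ← hG.fc_apply hc', ← hG.fc_apply hd']
    abel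
  · simp only [comp_apply, WithLp.ofLp_snd, Aop_apply_fst, Aop_apply_snd]
    rw [fc_add (ha'.fun_mul hc) (hd.fun_mul hc'),
      fc_add (hd.fun_mul hd') (continuous_ofReal.fun_mul (hc.fun_mul hb')),
      fc_mul_ofReal_mul hc hb' hM, hac, fc_mul hd hc', fc_mul hd hd']
    simp only [add_apply, mul_apply_eq_comp, map_add, ← hG.fc_adjoint_apply ha',
      ← hG.fc_adjoint_apply hb']
    abel

end CommHyp

/-- the algebra `𝒜` of matrix operators `A(a,b,c,d)`: adjoint and
composition formulas (Lemma 3.6). -/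
theorem stmt_9 (G : H →L[ℂ] H) (hG : CommHyp G) (a b c d a' b' c' d' : ℝ → ℂ)
    (ha : Continuous a) (hb : Continuous b) (hc : Continuous c) (hd : Continuous d)
    (ha' : Continuous a') (hb' : Continuous b') (hc' : Continuous c')
    (hd' : Continuous d') :
    ContinuousLinearMap.adjoint (Aop G a b c d)
      = Aop G (fun lam => starRingEnd ℂ (a lam)) (fun lam => starRingEnd ℂ (c lam))
          (fun lam => starRingEnd ℂ (b lam)) (fun lam => starRingEnd ℂ (d lam)) ∧
    (Aop G a b c d) ∘L (Aop G a' b' c' d')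
      = Aop G (fun lam => a lam * a' lam + (lam : ℂ) * (b lam * c' lam))
          (fun lam => a lam * b' lam + b lam * d' lam)
          (fun lam => a' lam * c lam + d lam * c' lam)
          (fun lam => d lam * d' lam + (lam : ℂ) * (c lam * b' lam)) := by
  exact ⟨hG.adjoint_Aop hb hc a d, hG.Aop_comp_Aop ha hb hc hd ha' hb' hc' hd'⟩

end
end

section
/- Let u be a solution of the nonlinear Landau–Zener system, v = (v₁,v₂) its gauge transform and σ(s) = s + m(u(s)). Then for every s ∈ ℝ: (d/ds)‖v₁(s)‖² = −(d/ds)‖v₂(s)‖² = −2·Im⟨v₁(s), Gv₂(s)⟩, and (d²/ds²)‖v₁(s)‖² = 4σ(s)·Re⟨v₁(s), Gv₂(s)⟩ + 2(‖Gv₂(s)‖² − ‖G*v₁(s)‖²). -/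
open ContinuousLinearMap Complex Filter Topology
open scoped InnerProductSpace

noncomputable section

variable {H : Type*} [NormedAddCommGroup H] [InnerProductSpace ℂ H] [CompleteSpace H]

omit [CompleteSpace H] in
/-- A differentiable function with values in `𝓗²` is differentiable componentwise. -/
theorem hasDerivAt_fst_snd {u : ℝ → WithLp 2 (H × H)} {u' : WithLp 2 (H × H)} {s : ℝ}
    (h : HasDerivAt u u' s) :
    HasDerivAt (fun t => (u t).fst) u'.fst s ∧ HasDerivAt (fun t => (u t).snd) u'.snd s := by
  have h' := ((WithLp.prodContinuousLinearEquiv 2 ℝ H H).hasFDerivAt (x := u s)).comp_hasDerivAt s h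
  exact ⟨h'.fst, h'.snd⟩

omit [CompleteSpace H] in
theorem continuous_Mscal_comp {δ : ℝ} {f₁ f₂ : ℝ × ℝ → ℝ} (hf₁ : Continuous f₁)
    (hf₂ : Continuous f₂) {u : ℝ → WithLp 2 (H × H)} (hu : Continuous u) :
    Continuous fun s => Mscal δ f₁ f₂ (u s) := by
  have h₁ : Continuous fun s => (u s).fst :=
    continuous_fst.comp ((WithLp.prodContinuousLinearEquiv 2 ℂ H H).continuous.comp hu)
  have h₂ : Continuous fun s => (u s).snd :=
    continuous_snd.comp ((WithLp.prodContinuousLinearEquiv 2 ℂ H H).continuous.comp hu)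
  unfold Mscal F1 F2
  fun_prop

/-- The gauge transform solves `−i v′(s) = V(σ(s))v(s)`. -/
theorem hasDerivAt_gaugeT {G : H →L[ℂ] H} {δ : ℝ} {f₁ f₂ : ℝ × ℝ → ℝ}
    (hf₁ : Continuous f₁) (hf₂ : Continuous f₂) {u : ℝ → WithLp 2 (H × H)}
    (hu : IsLZSol G δ f₁ f₂ u) (s : ℝ) :
    HasDerivAt (gaugeT δ f₁ f₂ u)
      (Complex.I • Vop G (sigma δ f₁ f₂ u s) (gaugeT δ f₁ f₂ u s)) s := by
  have hM := continuous_Mscal_comp (δ := δ) hf₁ hf₂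
    (continuous_iff_continuousAt.2 fun t => (hu t).continuousAt)
  have hphase : HasDerivAt
      (fun t : ℝ => Complex.exp (-(Complex.I * (∫ τ in (0:ℝ)..t, Mscal δ f₁ f₂ (u τ) : ℝ)))) _ s :=
    (((hM.integral_hasStrictDerivAt 0 s).hasDerivAt.ofReal_comp).const_mul Complex.I).neg.cexp
  refine (hphase.smul (hu s)).congr_deriv ?_
  simp only [gaugeT]
  generalize Complex.exp _ = c
  apply (WithLp.equiv 2 (H × H)).injective
  ext1
  · simp [Vop, eqv, nlt, sigma, mscal, Mscal]
    module
  · simp [Vop, eqv, nlt, sigma, mscal, Mscal]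
    module

/-- The derivatives of `‖w₁‖²`, `‖w₂‖²` and `⟨w₁, Gw₂⟩` along `−i w′ = V(r)w`. -/
theorem hasDerivAt_of_Vop {G : H →L[ℂ] H} {w : ℝ → WithLp 2 (H × H)} {r s : ℝ}
    (hw : HasDerivAt w (Complex.I • Vop G r (w s)) s) :
    HasDerivAt (fun t => ‖(w t).fst‖ ^ 2) (-2 * (⟪(w s).fst, G (w s).snd⟫_ℂ).im) s ∧
    HasDerivAt (fun t => ‖(w t).snd‖ ^ 2) (2 * (⟪(w s).fst, G (w s).snd⟫_ℂ).im) s ∧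
    HasDerivAt (fun t => ⟪(w t).fst, G (w t).snd⟫_ℂ)
      (Complex.I * (‖adjoint G (w s).fst‖ ^ 2 - ‖G (w s).snd‖ ^ 2
        - 2 * r * ⟪(w s).fst, G (w s).snd⟫_ℂ)) s := by
  obtain ⟨h₁, h₂⟩ := hasDerivAt_fst_snd hw
  have e₁ : (Complex.I • Vop G r (w s)).fst
      = Complex.I • ((r : ℂ) • (w s).fst + G (w s).snd) := rfl
  have e₂ : (Complex.I • Vop G r (w s)).snd
      = Complex.I • (adjoint G (w s).fst - (r : ℂ) • (w s).snd) := rfl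
  rw [e₁] at h₁
  rw [e₂] at h₂
  have hsq {x : ℝ → H} {x' : H} (hx : HasDerivAt x x' s) :
      HasDerivAt (fun t => ‖x t‖ ^ 2) (⟪x s, x'⟫_ℂ + ⟪x', x s⟫_ℂ).re s := by
    have := Complex.reCLM.hasFDerivAt.comp_hasDerivAt s (hx.inner ℂ hx)
    refine this.congr_of_eventuallyEq (.of_forall fun t => ?_)
    simp [inner_self_eq_norm_sq_to_K, ← Complex.ofReal_pow]
  have hswap : (⟪G (w s).snd, (w s).fst⟫_ℂ).im = -(⟪(w s).fst, G (w s).snd⟫_ℂ).im := by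
    rw [← inner_conj_symm, Complex.conj_im]
  refine ⟨(hsq h₁).congr_deriv ?_, (hsq h₂).congr_deriv ?_, ?_⟩
  · simp only [inner_smul_left, inner_smul_right, inner_add_left, inner_add_right,
      inner_self_eq_norm_sq_to_K]
    simp [← Complex.ofReal_pow, hswap]
    ring
  · simp only [inner_smul_left, inner_smul_right, inner_sub_left, inner_sub_right,
      adjoint_inner_left, adjoint_inner_right, inner_self_eq_norm_sq_to_K]
    simp [← Complex.ofReal_pow, hswap]
    ring
  · have hG : HasDerivAt (fun t => G (w t).snd) _ s :=
      (G.restrictScalars ℝ).hasFDerivAt.comp_hasDerivAt s h₂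
    refine (h₁.inner ℂ hG).congr_deriv ?_
    have hadj : ⟪(w s).fst, G (adjoint G (w s).fst)⟫_ℂ = (‖adjoint G (w s).fst‖ : ℂ) ^ 2 := by
      rw [← adjoint_inner_left, inner_self_eq_norm_sq_to_K]
      rfl
    simp only [coe_restrictScalars', map_smul, map_sub, inner_smul_left, inner_smul_right,
      inner_add_left, inner_sub_right, hadj, inner_self_eq_norm_sq_to_K]
    simp
    ring

/-- derivatives of the component masses of the gauge transform `v`
(identities (3.9) in the paper). -/
theorem stmt_13 (G : H →L[ℂ] H) (δ : ℝ) (f₁ f₂ : ℝ × ℝ → ℝ)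
    (hf₁ : C2Bdd f₁) (hf₂ : C2Bdd f₂)
    (u : ℝ → WithLp 2 (H × H)) (hu : IsLZSol G δ f₁ f₂ u)
    (v : ℝ → WithLp 2 (H × H)) (hv : v = gaugeT δ f₁ f₂ u) :
    ∀ s : ℝ,
      HasDerivAt (fun t : ℝ => ‖(v t).fst‖ ^ 2)
        (-2 * (⟪(v s).fst, G ((v s).snd)⟫_ℂ).im) s ∧
      HasDerivAt (fun t : ℝ => ‖(v t).snd‖ ^ 2)
        (2 * (⟪(v s).fst, G ((v s).snd)⟫_ℂ).im) s ∧
      HasDerivAt (fun t : ℝ => -2 * (⟪(v t).fst, G ((v t).snd)⟫_ℂ).im)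
        (4 * sigma δ f₁ f₂ u s * (⟪(v s).fst, G ((v s).snd)⟫_ℂ).re
          + 2 * (‖G ((v s).snd)‖ ^ 2 - ‖ContinuousLinearMap.adjoint G ((v s).fst)‖ ^ 2)) s := by
  intro s
  subst hv
  obtain ⟨h₁, h₂, h₃⟩ :=
    hasDerivAt_of_Vop (hasDerivAt_gaugeT hf₁.1.continuous hf₂.1.continuous hu s)
  refine ⟨h₁, h₂, ?_⟩
  refine ((Complex.imCLM.hasFDerivAt.comp_hasDerivAt s h₃).const_mul (-2)).congr_deriv ?_
  simp [← Complex.ofReal_pow]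
  ring

end
end
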